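/- Let W be the affine Weyl group of type A~n and let x, y ∈ W+ be dominant elements with x ≤ y. Define I(x,y) := {i ∈ {1,…,n} : the closure of A_z meets the hyperplane H_{αi,0} for some dominant z ∈ [x,y]}. Then for every λ ∈ ℤΦ lying in the ℤ≥0-span of {ϖi : i ∉ I(x,y)}, the map z ↦ z + λ is an isomorphism of posets from [x,y] ∩ W+ onto [x+λ, y+λ] ∩ W+ (both sets being ordered by the Bruhat order). -/

import Mathlib

noncomputable section

open scoped RealInnerProductSpace

/-- The Bruhat strict order on a Coxeter group: the transitive closure of the relation
"multiply on the left by a reflection, increasing the length". -/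
def bruhatLT {B : Type*} {W : Type*} [Group W] {M : CoxeterMatrix B}
    (cs : CoxeterSystem M W) : W → W → Prop :=
  Relation.TransGen (fun a b => (∃ t, cs.IsReflection t ∧ b = t * a) ∧ cs.length a < cs.length b)

/-- The Bruhat order on a Coxeter group. -/
def bruhatLE {B : Type*} {W : Type*} [Group W] {M : CoxeterMatrix B}
    (cs : CoxeterSystem M W) (x y : W) : Prop :=
  x = y ∨ bruhatLT cs x y

/-- The Bruhat interval `[x, y]` as a set. -/
def Iset {B : Type*} {W : Type*} [Group W] {M : CoxeterMatrix B}
    (cs : CoxeterSystem M W) (x y : W) : Set W :=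
  {z | bruhatLE cs x z ∧ bruhatLE cs z y}

/-- The Bruhat covers `U(x)` of an element `x`. -/
def Uset {B : Type*} {W : Type*} [Group W] {M : CoxeterMatrix B}
    (cs : CoxeterSystem M W) (x : W) : Set W :=
  {w | bruhatLT cs x w ∧ cs.length w = cs.length x + 1}

/-- The Bruhat cocovers `L(y)` of an element `y`. -/
def Lset {B : Type*} {W : Type*} [Group W] {M : CoxeterMatrix B}
    (cs : CoxeterSystem M W) (y : W) : Set W :=
  {w | bruhatLT cs w y ∧ cs.length y = cs.length w + 1}

/-- An interval `[x, y]` is full if it contains all Bruhat covers of `x` and all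
Bruhat cocovers of `y`. -/
def FullInt {B : Type*} {W : Type*} [Group W] {M : CoxeterMatrix B}
    (cs : CoxeterSystem M W) (x y : W) : Prop :=
  Uset cs x ⊆ Iset cs x y ∧ Lset cs y ⊆ Iset cs x y

/-- Two Bruhat intervals (possibly in different Coxeter groups) are isomorphic as posets. -/
def IntervalIso {B : Type*} {W : Type*} {B' : Type*} {W' : Type*} [Group W] [Group W']
    {M : CoxeterMatrix B} {M' : CoxeterMatrix B'}
    (cs : CoxeterSystem M W) (cs' : CoxeterSystem M' W') (x y : W) (x' y' : W') : Prop :=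
  ∃ f : {z : W // bruhatLE cs x z ∧ bruhatLE cs z y} ≃
        {z : W' // bruhatLE cs' x' z ∧ bruhatLE cs' z y'},
    ∀ u v, bruhatLE cs u.1 v.1 ↔ bruhatLE cs' (f u).1 (f v).1

/-- The group `G` of generic automorphisms: the subgroup of the permutation group of `W`
generated by the Dynkin diagram automorphisms `δ`, `σ` and inversion. -/
def Gsub {W : Type*} [Group W] (dl sg : W ≃* W) : Subgroup (Equiv.Perm W) :=
  Subgroup.closure {dl.toEquiv, sg.toEquiv, Equiv.inv W}

/-- The sum-zero hyperplane model of type `Aₙ`: `i`-th simple root `αᵢ = eᵢ - eᵢ₊₁`. -/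
def rootA {n : ℕ} (i : Fin n) : EuclideanSpace ℝ (Fin (n + 1)) :=
  EuclideanSpace.single i.castSucc 1 - EuclideanSpace.single i.succ 1

/-- The highest root `θ = e₀ - eₙ`. -/
def hiRoot (n : ℕ) : EuclideanSpace ℝ (Fin (n + 1)) :=
  EuclideanSpace.single 0 1 - EuclideanSpace.single (Fin.last n) 1

/-- The positive roots `eᵢ - eⱼ`, `i < j`. -/
def PhiPosN (n : ℕ) : Set (EuclideanSpace ℝ (Fin (n + 1))) :=
  {v | ∃ i j : Fin (n + 1), i < j ∧ v = EuclideanSpace.single i 1 - EuclideanSpace.single j 1}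

/-- The affine reflection `s_{α,k}` in the hyperplane `{v | (α, v) = k}`, for a root `α`
with `(α, α) = 2`. -/
def reflN {n : ℕ} (a : EuclideanSpace ℝ (Fin (n + 1))) (k : ℝ)
    (v : EuclideanSpace ℝ (Fin (n + 1))) : EuclideanSpace ℝ (Fin (n + 1)) :=
  v - (⟪a, v⟫ - k) • a

/-- The fundamental alcove `A₊` of type `Ãₙ`. -/
def AplusN (n : ℕ) : Set (EuclideanSpace ℝ (Fin (n + 1))) :=
  {v | ∀ a ∈ PhiPosN n, -1 < ⟪a, v⟫ ∧ ⟪a, v⟫ < 0}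

/-- `z` is dominant: its alcove is contained in the dominant chamber `C₊`. -/
def DomN {n : ℕ} {W : Type*} [Group W]
    (act : W →* Equiv.Perm (EuclideanSpace ℝ (Fin (n + 1)))) (z : W) : Prop :=
  ⇑(act z) '' AplusN n ⊆ {v | ∀ i : Fin n, 0 < ⟪rootA i, v⟫}

/-- The cone of nonnegative real combinations of the simple roots. -/
def coneN (n : ℕ) : Set (EuclideanSpace ℝ (Fin (n + 1))) :=
  {v | ∃ c : Fin n → ℝ, (∀ i, 0 ≤ c i) ∧ v = ∑ i, c i • rootA i}

/-- The root lattice `ℤΦ`. -/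
def rootLatN (n : ℕ) : Set (EuclideanSpace ℝ (Fin (n + 1))) :=
  {v | ∃ c : Fin n → ℤ, v = ∑ i, c i • rootA i}

/-- Exchange the entries `c` and `d` of a window of an affine permutation, up to a translation
by `k` periods. -/
def shiftSwap (N : ℕ) (x : ℕ → ℤ) (c d : ℕ) (k : ℤ) : ℕ → ℤ :=
  fun e => if e = c then x d + k * N else if e = d then x c - k * N else x e

/-- The sum of the first `p` coordinates of the vertex of type `j` of the alcove with window `x`. -/
def floorSum (N : ℕ) (x : ℕ → ℤ) (p : ℕ) (j : ℤ) : ℤ :=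
  ∑ e ∈ Finset.range p, (x e - j) / (N : ℤ)

/-- The first `N` entries are strictly decreasing. -/
def DecreasingOn (N : ℕ) (x : ℕ → ℤ) : Prop := ∀ e, e + 1 < N → x (e + 1) < x e

/-- Vertexwise dominance order on windows. -/
def DominatedBy (N : ℕ) (x y : ℕ → ℤ) : Prop :=
  ∀ p ≤ N, ∀ j, floorSum N x p j ≤ floorSum N y p j

theorem DominatedBy.trans {N : ℕ} {x y z : ℕ → ℤ} (hxy : DominatedBy N x y)
    (hyz : DominatedBy N y z) : DominatedBy N x z :=
  fun p hp j => (hxy p hp j).trans (hyz p hp j)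

theorem DecreasingOn.lt {N : ℕ} {x : ℕ → ℤ} (hx : DecreasingOn N x) {a b : ℕ} (hab : a < b)
    (hb : b < N) : x b < x a := by
  induction b, hab using Nat.le_induction with
  | base => exact hx a hb
  | succ b _ ih => exact (hx b hb).trans (ih (by omega))

theorem floorSum_succ (N : ℕ) (x : ℕ → ℤ) (p : ℕ) (j : ℤ) :
    floorSum N x (p + 1) j = floorSum N x p j + (x p - j) / (N : ℤ) :=
  Finset.sum_range_succ _ _

theorem floorSum_congr {N : ℕ} {x y : ℕ → ℤ} {p : ℕ} (h : ∀ e < p, x e = y e) (j : ℤ) :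
    floorSum N x p j = floorSum N y p j :=
  Finset.sum_congr rfl fun e he => by rw [h e (Finset.mem_range.1 he)]

theorem add_mul_sub_ediv {N : ℕ} (hN : 0 < N) (h k j : ℤ) :
    (h + k * N - j) / (N : ℤ) = (h - j) / N + k := by
  rw [show h + k * N - j = (h - j) + k * N by ring, Int.add_mul_ediv_right _ _ (by positivity)]

theorem floorSum_add_mul {N : ℕ} (hN : 0 < N) (x : ℕ → ℤ) (p : ℕ) (j q : ℤ) :
    floorSum N x p (j + q * N) = floorSum N x p j - p * q := by
  induction p with
  | zero => simp [floorSum]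
  | succ p ih =>
    have h := add_mul_sub_ediv hN (x p) (-q) j
    rw [floorSum_succ, floorSum_succ, ih,
      show x p - (j + q * N) = x p + (-q) * N - j by ring, h]
    push_cast
    ring

theorem floorSum_shiftSwap {N : ℕ} (hN : 0 < N) (x : ℕ → ℤ) {c d : ℕ} (hcd : c < d) (k : ℤ)
    (p : ℕ) (j : ℤ) :
    floorSum N (shiftSwap N x c d k) p j = floorSum N x p j +
      if c < p ∧ p ≤ d then (x d + k * N - j) / (N : ℤ) - (x c - j) / N else 0 := by
  induction p with
  | zero => simp [floorSum]
  | succ p ih =>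
    have h1 := add_mul_sub_ediv hN (x d) k j
    have h2 := add_mul_sub_ediv hN (x c) (-k) j
    rw [show x c + -k * N - j = x c - k * N - j by ring] at h2
    rw [floorSum_succ, floorSum_succ, ih]
    unfold shiftSwap
    rcases lt_trichotomy p c with h | h | h
    · rw [if_neg (by omega), if_neg (by omega), if_neg (by omega), if_neg (by omega)]
      ring
    · subst h
      rw [if_neg (by omega), if_pos rfl, if_pos (by omega)]
      ring
    · rcases lt_trichotomy p d with h' | h' | h'
      · rw [if_pos (by omega), if_neg (by omega), if_neg (by omega), if_pos (by omega)]
        ring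
      · subst h'
        rw [if_pos (by omega), if_neg (by omega), if_pos (by omega), if_neg (by omega), h1, h2]
        ring
      · rw [if_neg (by omega), if_neg (by omega), if_neg (by omega), if_neg (by omega)]
        ring

theorem sub_one_ediv_of_not_dvd {N : ℕ} (hN : 0 < N) {h : ℤ} (hd : ¬ (N : ℤ) ∣ h) :
    (h - 1) / (N : ℤ) = h / N := by
  have hN' : (0 : ℤ) < N := by exact_mod_cast hN
  have h1 := Int.emod_nonneg h hN'.ne'
  have h2 := Int.emod_lt_of_pos h hN'
  have h3 : h % N ≠ 0 := fun h' => hd (Int.dvd_of_emod_eq_zero h')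
  have h4 := Int.mul_ediv_add_emod h N
  rw [show h - 1 = (h % N - 1) + (h / N) * N by linarith [mul_comm (h / (N : ℤ)) N],
    Int.add_mul_ediv_right _ _ hN'.ne', Int.ediv_eq_zero_of_lt (by omega) (by omega), zero_add]

theorem ediv_eq_neg_one {N : ℕ} {h : ℤ} (h1 : h < 0) (h2 : -N ≤ h) : h / (N : ℤ) = -1 := by
  rw [Int.ediv_eq_iff_of_pos (by omega)]
  constructor <;> linarith

theorem exists_shiftSwap_dominatedBy {N : ℕ} (hN : 0 < N) {x y : ℕ → ℤ} (hx : DecreasingOn N x)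
    (hy : DecreasingOn N y) (hinj : ∀ a < N, ∀ b < N, (N : ℤ) ∣ x a - x b → a = b)
    (htot : ∀ j, floorSum N x N j = floorSum N y N j) (hle : DominatedBy N x y)
    (hne : ∃ e, e < N ∧ x e ≠ y e) :
    ∃ c d k, c < d ∧ d < N ∧ x c < x d + k * N ∧ DecreasingOn N (shiftSwap N x c d k) ∧
      DominatedBy N (shiftSwap N x c d k) y := by
  classical
  have hN' : (0 : ℤ) < N := by exact_mod_cast hN
  obtain ⟨c, ⟨hcN, hxyc⟩, hcmin⟩ : ∃ c, (c < N ∧ x c ≠ y c) ∧ ∀ e < c, x e = y e :=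
    ⟨Nat.find hne, Nat.find_spec hne, fun e he => by
      by_contra h
      exact Nat.find_min hne he ⟨he.trans (Nat.find_spec hne).1, h⟩⟩
  obtain ⟨D, hD⟩ : ∃ D : ℕ → ℤ → ℤ, ∀ p j, D p j = floorSum N y p j - floorSum N x p j :=
    ⟨_, fun _ _ => rfl⟩
  have hDnn : ∀ p ≤ N, ∀ j, 0 ≤ D p j := fun p hp j => by
    rw [hD]; linarith [hle p hp j]
  have hDsucc : ∀ p j, D (p + 1) j = D p j + ((y p - j) / (N : ℤ) - (x p - j) / N) := fun p j => by
    simp only [hD, floorSum_succ]; ring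
  have hDc : ∀ j, D c j = 0 := fun j => by
    rw [hD, floorSum_congr hcmin, sub_self]
  have hDper : ∀ p j q, D p (j + q * N) = D p j := fun p j q => by
    rw [hD, hD, floorSum_add_mul hN, floorSum_add_mul hN]; ring
  have hDc1 : ∀ j, D (c + 1) j = (y c - j) / (N : ℤ) - (x c - j) / N := fun j => by
    rw [hDsucc, hDc, zero_add]
  have hlt : x c < y c := by
    have h := hDnn (c + 1) hcN (x c)
    rw [hDc1, sub_self, Int.zero_ediv, sub_zero] at h
    have := (Int.ediv_nonneg_iff_of_pos hN').1 h
    omega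
  obtain ⟨a, ha⟩ : ∃ a, a = x c := ⟨_, rfl⟩
  have hP : ∃ p, c < p ∧ D p (a + 1) = 0 := ⟨N, hcN, by rw [hD, htot, sub_self]⟩
  obtain ⟨P, hcP, hDP, hPN, hPmin⟩ : ∃ P, c < P ∧ D P (a + 1) = 0 ∧ P ≤ N ∧
      ∀ p, c < p → p < P → 1 ≤ D p (a + 1) := by
    have hPN : Nat.find hP ≤ N := Nat.find_min' hP ⟨hcN, by rw [hD, htot, sub_self]⟩
    refine ⟨Nat.find hP, (Nat.find_spec hP).1, (Nat.find_spec hP).2, hPN, fun p hp hpP => ?_⟩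
    have h0 := hDnn p (hpP.le.trans hPN) (a + 1)
    have h1 : D p (a + 1) ≠ 0 := fun h => Nat.find_min hP hpP ⟨hp, h⟩
    omega
  have hDc1' : 1 ≤ D (c + 1) (a + 1) := by
    have h1 : (x c - (a + 1)) / (N : ℤ) = -1 := ediv_eq_neg_one (by omega) (by omega)
    have h2 : 0 ≤ (y c - (a + 1)) / (N : ℤ) := Int.ediv_nonneg (by omega) (by omega)
    rw [hDc1]; omega
  have hc1P : c + 1 < P := by
    rcases Nat.lt_or_ge (c + 1) P with h | h
    · exact h
    · have : P = c + 1 := by omega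
      subst this
      omega
  have hr : ∃ r : ℕ, 0 < r ∧ ∃ e, c < e ∧ e < P ∧ (N : ℤ) ∣ a + r - x e := by
    refine ⟨((x (c + 1) - a) % N + N).toNat, ?_, c + 1, by omega, hc1P, ?_⟩
    · have := Int.emod_nonneg (x (c + 1) - a) hN'.ne'
      omega
    · have h1 := Int.emod_nonneg (x (c + 1) - a) hN'.ne'
      have h2 := Int.mul_ediv_add_emod (x (c + 1) - a) N
      rw [Int.toNat_of_nonneg (by omega)]
      exact ⟨1 - (x (c + 1) - a) / N, by linarith⟩
  obtain ⟨r, hr0, ⟨d, hcd, hdP, k, hk⟩, hrmin⟩ : ∃ r : ℕ, 0 < r ∧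
      (∃ e, c < e ∧ e < P ∧ (N : ℤ) ∣ a + r - x e) ∧
      ∀ r' : ℕ, 0 < r' → r' < r → ∀ e, c < e → e < P → ¬ (N : ℤ) ∣ a + r' - x e :=
    ⟨Nat.find hr, (Nat.find_spec hr).1, (Nat.find_spec hr).2, fun r' h0 h1 e h2 h3 h4 =>
      Nat.find_min hr h1 ⟨h0, e, h2, h3, h4⟩⟩
  have hrN : r < N := by
    have hrne : r ≠ N := by
      rintro rfl
      have := hinj c hcN d (by omega) ⟨k - 1, by rw [← ha]; linarith⟩
      omega
    by_contra h
    refine hrmin (r - N) (by omega) (by omega) d hcd hdP ⟨k - 1, ?_⟩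
    push_cast [show N ≤ r by omega]
    linarith
  have hb : x d + k * N = a + r := by linarith
  have hndvd : ∀ j, a < j → j < a + r → ∀ e, c ≤ e → e < P → ¬ (N : ℤ) ∣ x e - j := by
    intro j hj1 hj2 e he1 he2 hdvd
    rcases he1.eq_or_lt with rfl | he1
    · have := Int.le_of_dvd (by omega) ((dvd_neg).2 hdvd)
      omega
    · refine hrmin (j - a).toNat (by omega) (by omega) e he1 he2 ?_
      rw [Int.toNat_of_nonneg (by omega)]
      have := (dvd_neg).2 hdvd
      rwa [show a + (j - a) - x e = -(x e - j) by ring]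
  have hanti : ∀ j, a < j → j < a + r → ∀ p, c ≤ p → ∀ q, p ≤ q → q ≤ P →
      D q (j + 1) - D q j ≤ D p (j + 1) - D p j := by
    intro j hj1 hj2 p hp q hpq
    induction q, hpq using Nat.le_induction with
    | base => intro _; exact le_rfl
    | succ q hq ih =>
      intro hqP
      have h1 := sub_one_ediv_of_not_dvd hN (hndvd j hj1 hj2 q (by omega) (by omega))
      rw [show x q - j - 1 = x q - (j + 1) by ring] at h1
      have h2 : (y q - (j + 1)) / (N : ℤ) ≤ (y q - j) / N :=
        Int.ediv_le_ediv hN' (by omega)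
      rw [hDsucc, hDsucc]
      linarith [ih (by omega)]
  have hconst : ∀ i : ℕ, i < r → D P (a + 1 + i) = 0 ∧
      ∀ p, c ≤ p → p ≤ P → D p (a + 1 + i) = D p (a + 1) := by
    intro i
    induction i with
    | zero => intro _; simp [hDP]
    | succ i ih =>
      intro hi
      obtain ⟨h1, h2⟩ := ih (by omega)
      have key := hanti (a + 1 + i) (by omega) (by omega)
      have h3 := hDnn P hPN (a + 1 + i + 1)
      have hz : ∀ p, c ≤ p → p ≤ P → D p (a + 1 + i + 1) = D p (a + 1 + i) := by
        intro p hp hpP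
        have h4 := key p hp P hpP le_rfl
        have h5 := key c le_rfl p hp hpP
        rw [hDc, hDc] at h5
        omega
      push_cast
      rw [← add_assoc]
      exact ⟨by rw [hz P hcP.le le_rfl, h1], fun p hp hpP => by rw [hz p hp hpP, h2 p hp hpP]⟩
  have hpos : ∀ j, a < j → j ≤ a + r → ∀ p, c < p → p < P → 1 ≤ D p j := by
    intro j hj1 hj2 p hp hpP
    have := (hconst (j - a - 1).toNat (by omega)).2 p hp.le hpP.le
    rw [Int.toNat_of_nonneg (by omega), show a + 1 + (j - a - 1) = j by ring] at this
    rw [this]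
    exact hPmin p hp hpP
  have hbyc : a + r ≤ y c := by
    have h := hpos (a + r) (by omega) le_rfl (c + 1) (by omega) hc1P
    have h' : (x c - (a + r)) / (N : ℤ) = -1 := ediv_eq_neg_one (by omega) (by omega)
    rw [hDc1, h'] at h
    have := (Int.ediv_nonneg_iff_of_pos (a := y c - (a + r)) hN').1 (by omega)
    omega
  have hnext : d + 1 < N → x (d + 1) < a - k * N := by
    intro hd1
    have hne1 : x (d + 1) + k * N ≠ a := fun h => by
      have := hinj c hcN (d + 1) hd1 ⟨k, by rw [← ha]; linarith⟩
      omega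
    have hltd := hx d hd1
    suffices x (d + 1) + k * N ≤ a by
      have := lt_of_le_of_ne this hne1
      linarith
    rcases Nat.lt_or_ge (d + 1) P with h | h
    · by_contra hcon
      refine hrmin (x (d + 1) + k * N - a).toNat (by omega) (by omega) (d + 1) (by omega) h ?_
      rw [Int.toNat_of_nonneg (by omega)]
      exact ⟨k, by ring⟩
    · have hP' : P = d + 1 := by omega
      subst hP'
      have h1 := hPmin d hcd hdP
      have h2 := hDnn (d + 1 + 1) hd1 (a + 1)
      rw [hDsucc, hDP] at h2
      rw [hDsucc] at hDP
      have h3 : (y (d + 1) - (a + 1)) / (N : ℤ) ≤ (y d - (a + 1)) / N :=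
        Int.ediv_le_ediv hN' (by have := hy d hd1; omega)
      have h4 : (x d - (a + 1)) / (N : ℤ) = -k := by
        have := add_mul_sub_ediv hN (x d) k (a + 1)
        rw [hb, Int.ediv_eq_zero_of_lt (by omega) (by omega)] at this
        omega
      have h5 : (x (d + 1) - (a + 1)) / (N : ℤ) < -k := by omega
      have h6 := (Int.ediv_lt_iff_lt_mul hN').1 h5
      linarith
  refine ⟨c, d, k, hcd, by omega, by omega, ?_, ?_⟩
  · intro e he
    have hprev : 0 < c → x d + k * N < x (c - 1) := fun h0 => by
      have h1 := hy (c - 1) (by omega)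
      rw [show c - 1 + 1 = c by omega] at h1
      rw [hcmin (c - 1) (by omega)]
      omega
    have h0 := hx e he
    have h2 := hx.lt hcd (by omega)
    unfold shiftSwap
    by_cases e1 : e + 1 = c
    · have : e = c - 1 := by omega
      rw [if_pos e1, if_neg (by omega), if_neg (by omega), this]
      exact hprev (by omega)
    · by_cases e2 : e = c
      · subst e2
        rw [if_neg e1, if_pos rfl]
        split_ifs with h <;> linarith
      · by_cases e3 : e + 1 = d
        · rw [if_neg e1, if_pos e3, if_neg e2, if_neg (by omega)]
          rw [e3] at h0
          linarith
        · by_cases e4 : e = d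
          · subst e4
            rw [if_neg e1, if_neg e3, if_neg e2, if_pos rfl, ← ha]
            exact hnext he
          · rw [if_neg e1, if_neg e3, if_neg e2, if_neg e4]
            exact h0
  · intro p hp j
    rw [floorSum_shiftSwap hN x hcd]
    split_ifs with h
    · obtain ⟨j₀, q, hj, h1, h2⟩ : ∃ j₀ q : ℤ, j = j₀ + q * N ∧ a < j₀ ∧ j₀ ≤ a + N :=
        ⟨a + 1 + (j - a - 1) % N, (j - a - 1) / N, by
          linarith [Int.mul_ediv_add_emod (j - a - 1) N], by
          have := Int.emod_nonneg (j - a - 1) hN'.ne'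
          omega, by
          have := Int.emod_lt_of_pos (j - a - 1) hN'
          omega⟩
      have hDj := hDper p j₀ q
      rw [← hj] at hDj
      have e1 := add_mul_sub_ediv hN (x d + k * N) (-q) j₀
      have e2 := add_mul_sub_ediv hN (x c) (-q) j₀
      rw [show x d + k * N + -q * N - j₀ = x d + k * N - j by rw [hj]; ring] at e1
      rw [show x c + -q * N - j₀ = x c - j by rw [hj]; ring] at e2
      have e3 : (x c - j₀) / (N : ℤ) = -1 := ediv_eq_neg_one (by omega) (by omega)
      have e4 := hD p j
      rw [e1, e2, e3]
      by_cases hjb : j₀ ≤ a + r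
      · have h5 := hpos j₀ h1 hjb p h.1 (by omega)
        rw [hb, Int.ediv_eq_zero_of_lt (by omega) (by omega)]
        omega
      · rw [hb, ediv_eq_neg_one (by omega) (by omega)]
        have := hDnn p hp j₀
        omega
    · linarith [hle p hp j]

/-- For every type of vertex, the vertex of `x` is weakly majorized by the vertex of `y`. -/
def MajorizedBy (N : ℕ) (x y : ℕ → ℤ) : Prop :=
  ∀ j : ℤ, ∀ S ⊆ Finset.range N, ∃ T ⊆ Finset.range N, T.card = S.card ∧
    ∑ e ∈ S, (x e - j) / (N : ℤ) ≤ ∑ e ∈ T, (y e - j) / (N : ℤ)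

theorem MajorizedBy.refl (N : ℕ) (x : ℕ → ℤ) : MajorizedBy N x x :=
  fun _ S hS => ⟨S, hS, rfl, le_rfl⟩

theorem MajorizedBy.trans {N : ℕ} {x y z : ℕ → ℤ} (hxy : MajorizedBy N x y)
    (hyz : MajorizedBy N y z) : MajorizedBy N x z := by
  intro j S hS
  obtain ⟨T, hT, hTc, hle⟩ := hxy j S hS
  obtain ⟨U, hU, hUc, hle'⟩ := hyz j T hT
  exact ⟨U, hU, hUc.trans hTc, hle.trans hle'⟩

theorem shiftSwap_comm (N : ℕ) (x : ℕ → ℤ) {c d : ℕ} (hcd : c ≠ d) (k : ℤ) :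
    shiftSwap N x d c (-k) = shiftSwap N x c d k := by
  funext e
  unfold shiftSwap
  split_ifs with h1 h2 <;> first | (exfalso; omega) | ring

theorem shiftSwap_shiftSwap (N : ℕ) (x : ℕ → ℤ) {c d : ℕ} (hcd : c ≠ d) (k : ℤ) :
    shiftSwap N (shiftSwap N x c d k) c d k = x := by
  funext e
  unfold shiftSwap
  split_ifs with h1 h2 <;> first | (exfalso; omega) | (subst_vars; ring)

theorem majorizedBy_shiftSwap {N : ℕ} (hN : 0 < N) (x : ℕ → ℤ) {c d : ℕ} (hcd : c ≠ d)
    (hc : c < N) {k : ℤ} (hk : 0 ≤ k) (hlt : x c ≤ x d + k * N) :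
    MajorizedBy N x (shiftSwap N x c d k) := by
  classical
  intro j S hS
  have hN' : (0 : ℤ) < N := by exact_mod_cast hN
  have h1 := add_mul_sub_ediv hN (x d) k j
  have h2 := add_mul_sub_ediv hN (x c) (-k) j
  rw [show x c + -k * N - j = x c - k * N - j by ring] at h2
  have h3 : (x c - j) / (N : ℤ) ≤ (x d + k * N - j) / N := Int.ediv_le_ediv hN' (by linarith)
  have hoff : ∀ e, e ≠ c → e ≠ d → shiftSwap N x c d k e = x e := fun e he1 he2 => by
    rw [shiftSwap, if_neg he1, if_neg he2]
  have hvc : shiftSwap N x c d k c = x d + k * N := by rw [shiftSwap, if_pos rfl]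
  have hvd : shiftSwap N x c d k d = x c - k * N := by
    rw [shiftSwap, if_neg hcd.symm, if_pos rfl]
  have hsum : ∀ U : Finset ℕ, c ∉ U → d ∉ U →
      ∑ e ∈ U, (x e - j) / (N : ℤ) = ∑ e ∈ U, (shiftSwap N x c d k e - j) / (N : ℤ) := by
    intro U hcU hdU
    refine Finset.sum_congr rfl fun e he => ?_
    rw [hoff e (fun h => hcU (h ▸ he)) (fun h => hdU (h ▸ he))]
  by_cases hcS : c ∈ S
  · refine ⟨S, hS, rfl, ?_⟩
    by_cases hdS : d ∈ S
    · have hd' : d ∈ S.erase c := Finset.mem_erase.2 ⟨hcd.symm, hdS⟩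
      rw [← Finset.add_sum_erase _ _ hcS, ← Finset.add_sum_erase _ _ hd',
        ← Finset.add_sum_erase _ _ hcS, ← Finset.add_sum_erase _ _ hd', hvc, hvd, h1, h2,
        hsum _ (by simp) (by simp)]
      linarith
    · rw [← Finset.add_sum_erase _ _ hcS, ← Finset.add_sum_erase _ _ hcS, hvc,
        hsum _ (by simp) (by simp [hdS])]
      linarith
  · by_cases hdS : d ∈ S
    · refine ⟨insert c (S.erase d), ?_, ?_, ?_⟩
      · intro e he
        rcases Finset.mem_insert.1 he with rfl | he
        · exact Finset.mem_range.2 hc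
        · exact hS (Finset.mem_of_mem_erase he)
      · rw [Finset.card_insert_of_notMem (by simp [hcS]), Finset.card_erase_add_one hdS]
      · rw [Finset.sum_insert (by simp [hcS]), ← Finset.add_sum_erase _ _ hdS, hvc,
          hsum _ (by simp [hcS]) (by simp), h1]
        linarith
    · exact ⟨S, hS, rfl, (hsum S hcS hdS).le⟩

theorem sum_le_sum_range_card {N : ℕ} {f : ℕ → ℤ} (hf : ∀ a b, a ≤ b → b < N → f b ≤ f a)
    {S : Finset ℕ} (hS : S ⊆ Finset.range N) :
    ∑ e ∈ S, f e ≤ ∑ e ∈ Finset.range S.card, f e := by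
  classical
  have hcard : (S \ Finset.range S.card).card = (Finset.range S.card \ S).card :=
    Finset.card_sdiff_comm (by simp)
  rw [← Finset.sum_inter_add_sum_sdiff S (Finset.range S.card),
    ← Finset.sum_inter_add_sum_sdiff (Finset.range S.card) S, Finset.inter_comm]
  refine add_le_add le_rfl ?_
  rcases (S \ Finset.range S.card).eq_empty_or_nonempty with h | ⟨m, hm⟩
  · rw [h, Finset.card_empty] at hcard
    rw [h, Finset.card_eq_zero.1 hcard.symm]
  · simp only [Finset.mem_sdiff, Finset.mem_range, not_lt] at hm
    have hmN := Finset.mem_range.1 (hS hm.1)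
    calc ∑ e ∈ S \ Finset.range S.card, f e
        ≤ (S \ Finset.range S.card).card • f S.card := by
          refine Finset.sum_le_card_nsmul _ _ _ fun e he => ?_
          simp only [Finset.mem_sdiff, Finset.mem_range, not_lt] at he
          exact hf _ _ he.2 (Finset.mem_range.1 (hS he.1))
      _ = (Finset.range S.card \ S).card • f S.card := by rw [hcard]
      _ ≤ ∑ e ∈ Finset.range S.card \ S, f e := by
          refine Finset.card_nsmul_le_sum _ _ _ fun e he => ?_
          simp only [Finset.mem_sdiff, Finset.mem_range] at he
          exact hf _ _ he.1.le (by omega)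

theorem MajorizedBy.dominatedBy {N : ℕ} (hN : 0 < N) {x y : ℕ → ℤ} (h : MajorizedBy N x y)
    (hy : DecreasingOn N y) : DominatedBy N x y := by
  intro p hp j
  obtain ⟨T, hT, hTc, hle⟩ := h j (Finset.range p) (Finset.range_mono hp)
  rw [Finset.card_range] at hTc
  refine hle.trans ?_
  unfold floorSum
  rw [← hTc]
  refine sum_le_sum_range_card (fun a b hab hb => ?_) hT
  refine Int.ediv_le_ediv (by exact_mod_cast hN) ?_
  rcases hab.eq_or_lt with rfl | hab
  · exact le_rfl
  · linarith [hy.lt hab hb]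

theorem floorSum_total_shiftSwap {N : ℕ} (hN : 0 < N) (x : ℕ → ℤ) {c d : ℕ} (hcd : c ≠ d)
    (hc : c < N) (hd : d < N) (k : ℤ) (j : ℤ) :
    floorSum N (shiftSwap N x c d k) N j = floorSum N x N j := by
  rcases hcd.lt_or_gt with h | h
  · rw [floorSum_shiftSwap hN x h, if_neg (by omega), add_zero]
  · rw [← shiftSwap_comm N x hcd, floorSum_shiftSwap hN x h, if_neg (by omega), add_zero]

theorem sum_le_of_dominatedBy {N : ℕ} (hN : 0 < N) {x y : ℕ → ℤ} (h : DominatedBy N x y) {p : ℕ}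
    (hp : p ≤ N) : ∑ e ∈ Finset.range p, x e ≤ ∑ e ∈ Finset.range p, (y e + N) := by
  have hN' : (0 : ℤ) < N := by exact_mod_cast hN
  have h0 := h p hp 0
  calc ∑ e ∈ Finset.range p, x e
      ≤ ∑ e ∈ Finset.range p, (N * ((x e - 0) / (N : ℤ)) + N) :=
        Finset.sum_le_sum fun e _ => by
          have h1 := Int.mul_ediv_add_emod (x e - 0) N
          have h2 := Int.emod_lt_of_pos (x e - 0) hN'
          linarith
    _ = N * floorSum N x p 0 + p * N := by
        rw [Finset.sum_add_distrib, ← Finset.mul_sum]; simp [floorSum]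
    _ ≤ N * floorSum N y p 0 + p * N := by gcongr
    _ = ∑ e ∈ Finset.range p, (N * ((y e - 0) / (N : ℤ)) + N) := by
        rw [Finset.sum_add_distrib, ← Finset.mul_sum]; simp [floorSum]
    _ ≤ ∑ e ∈ Finset.range p, (y e + N) :=
        Finset.sum_le_sum fun e _ => by
          have h1 := Int.mul_ediv_add_emod (y e - 0) N
          have h2 := Int.emod_nonneg (y e - 0) hN'.ne'
          linarith

theorem sum_shiftSwap {N : ℕ} (x : ℕ → ℤ) {c d : ℕ} (hcd : c < d) (k : ℤ) (p : ℕ) :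
    ∑ e ∈ Finset.range p, shiftSwap N x c d k e = ∑ e ∈ Finset.range p, x e +
      if c < p ∧ p ≤ d then x d + k * N - x c else 0 := by
  induction p with
  | zero => simp
  | succ p ih =>
    rw [Finset.sum_range_succ, Finset.sum_range_succ, ih]
    unfold shiftSwap
    rcases lt_trichotomy p c with h | h | h
    · rw [if_neg (by omega), if_neg (by omega), if_neg (by omega), if_neg (by omega)]
      ring
    · subst h
      rw [if_neg (by omega), if_pos rfl, if_pos (by omega)]
      ring
    · rcases lt_trichotomy p d with h' | h' | h'
      · rw [if_pos (by omega), if_neg (by omega), if_neg (by omega), if_pos (by omega)]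
        ring
      · subst h'
        rw [if_pos (by omega), if_neg (by omega), if_pos (by omega), if_neg (by omega)]
        ring
      · rw [if_neg (by omega), if_neg (by omega), if_neg (by omega), if_neg (by omega)]
        ring

/-- The gap between two windows, a decreasing measure along chains of `shiftSwap`s. -/
def windowGap (N : ℕ) (x y : ℕ → ℤ) : ℤ :=
  ∑ p ∈ Finset.range (N + 1), (∑ e ∈ Finset.range p, (y e + N) - ∑ e ∈ Finset.range p, x e)

theorem windowGap_nonneg {N : ℕ} (hN : 0 < N) {x y : ℕ → ℤ} (h : DominatedBy N x y) :
    0 ≤ windowGap N x y :=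
  Finset.sum_nonneg fun _ hp =>
    sub_nonneg.2 (sum_le_of_dominatedBy hN h (Nat.lt_succ_iff.1 (Finset.mem_range.1 hp)))

theorem windowGap_shiftSwap_lt {N : ℕ} {x : ℕ → ℤ} (y : ℕ → ℤ) {c d : ℕ} (hcd : c < d)
    (hd : d < N) {k : ℤ} (hlt : x c < x d + k * N) :
    windowGap N (shiftSwap N x c d k) y < windowGap N x y := by
  refine Finset.sum_lt_sum (fun p _ => ?_) ⟨d, Finset.mem_range.2 (by omega), ?_⟩
  · rw [sum_shiftSwap x hcd]
    split_ifs <;> linarith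
  · rw [sum_shiftSwap x hcd, if_pos ⟨hcd, le_rfl⟩]
    linarith

/-- The reflection in the hyperplane `v c - v d = k`, in coordinates. -/
def rootRefl {n : ℕ} (c d : Fin (n + 1)) (k : ℤ) (v : EuclideanSpace ℝ (Fin (n + 1))) :
    EuclideanSpace ℝ (Fin (n + 1)) :=
  WithLp.toLp 2 fun e => if e = c then v d + k else if e = d then v c - k else v e

theorem rootRefl_apply {n : ℕ} (c d : Fin (n + 1)) (k : ℤ) (v : EuclideanSpace ℝ (Fin (n + 1)))
    (e : Fin (n + 1)) :
    rootRefl c d k v e = if e = c then v d + k else if e = d then v c - k else v e := rfl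

theorem inner_single_sub_single {n : ℕ} (c d : Fin (n + 1))
    (v : EuclideanSpace ℝ (Fin (n + 1))) :
    ⟪(EuclideanSpace.single c 1 - EuclideanSpace.single d 1 : EuclideanSpace ℝ (Fin (n + 1))), v⟫ =
      v c - v d := by
  rw [inner_sub_left, EuclideanSpace.inner_single_left, EuclideanSpace.inner_single_left]
  simp

theorem reflN_single_sub_single {n : ℕ} {c d : Fin (n + 1)} (hcd : c ≠ d) (k : ℤ)
    (v : EuclideanSpace ℝ (Fin (n + 1))) :
    reflN (EuclideanSpace.single c 1 - EuclideanSpace.single d 1) k v = rootRefl c d k v := by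
  ext e
  rw [rootRefl_apply, reflN, inner_single_sub_single]
  simp only [PiLp.sub_apply, PiLp.smul_apply, PiLp.single_apply, smul_eq_mul]
  split_ifs with h1 h2 <;> first | (exfalso; exact hcd (h1.symm.trans h2)) | (subst_vars; ring)

theorem rootRefl_comm {n : ℕ} {c d : Fin (n + 1)} (hcd : c ≠ d) (k : ℤ)
    (v : EuclideanSpace ℝ (Fin (n + 1))) : rootRefl d c (-k) v = rootRefl c d k v := by
  ext e
  rw [rootRefl_apply, rootRefl_apply]
  split_ifs with h1 h2 <;>
    first | (exfalso; exact hcd (h2.symm.trans h1)) | (subst_vars; push_cast; ring)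

/-- The setting of the affine Weyl group of type `Ãₙ` acting by affine reflections. -/
structure IsAffineAction {n : ℕ} {W : Type*} [Group W] {M : CoxeterMatrix (Fin (n + 1))}
    (cs : CoxeterSystem M W) (act : W →* Equiv.Perm (EuclideanSpace ℝ (Fin (n + 1)))) : Prop where
  one_le : 1 ≤ n
  matrix : ∀ i j : Fin (n + 1), M i j =
    if i = j then 1 else if n = 1 then 0 else if j = i + 1 ∨ i = j + 1 then 3 else 2
  simple_zero : ∀ v, act (cs.simple 0) v = reflN (hiRoot n) (-1) v
  simple_succ : ∀ (i : Fin n) (v), act (cs.simple i.succ) v = reflN (rootA i) 0 v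

/-- The translation part of the simple reflection `i`. -/
def simpleShift {n : ℕ} (i : Fin (n + 1)) : ℤ := if i = 0 then 1 else 0

/-- The affine functional cutting out the wall `i` of the fundamental alcove. -/
def wallForm {n : ℕ} (i : Fin (n + 1)) (v : EuclideanSpace ℝ (Fin (n + 1))) : ℝ :=
  v i - v (i - 1) + simpleShift i

/-- An interior point of the fundamental alcove. -/
def basePoint (n : ℕ) : EuclideanSpace ℝ (Fin (n + 1)) :=
  WithLp.toLp 2 fun e => (e : ℝ) / (n + 1)

theorem basePoint_apply {n : ℕ} (e : Fin (n + 1)) : basePoint n e = (e : ℝ) / (n + 1) := rfl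

theorem val_sub_val_add_simpleShift {n : ℕ} (i : Fin (n + 1)) :
    (i : ℤ) - ((i - 1 : Fin (n + 1)) : ℕ) + simpleShift i * (n + 1) = 1 := by
  unfold simpleShift
  rcases eq_or_ne i 0 with rfl | h
  · rw [if_pos rfl, zero_sub]
    rw [Fin.coe_neg_one]
    simp
  · rw [if_neg h, Fin.val_sub_one_of_ne_zero h]
    have : (i : ℕ) ≠ 0 := fun h' => h (Fin.ext h')
    omega

theorem wallForm_basePoint_pos {n : ℕ} (i : Fin (n + 1)) : 0 < wallForm i (basePoint n) := by
  have h : ((i : ℤ) - ((i - 1 : Fin (n + 1)) : ℕ) + simpleShift i * (n + 1) : ℝ) = 1 := by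
    exact_mod_cast val_sub_val_add_simpleShift i
  have hn : (0 : ℝ) < n + 1 := by positivity
  have : wallForm i (basePoint n) = 1 / (n + 1) := by
    rw [wallForm, basePoint_apply, basePoint_apply, eq_div_iff hn.ne']
    push_cast at h
    field_simp
    linarith [h]
  rw [this]
  positivity

namespace IsAffineAction

variable {n : ℕ} {W : Type*} [Group W] {M : CoxeterMatrix (Fin (n + 1))}
  {cs : CoxeterSystem M W} {act : W →* Equiv.Perm (EuclideanSpace ℝ (Fin (n + 1)))}

theorem sub_one_ne (h : IsAffineAction cs act) (i : Fin (n + 1)) : i - 1 ≠ i := by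
  have h1 : (1 : Fin (n + 1)) ≠ 0 := by
    have := h.one_le
    intro h0
    have h2 := congrArg Fin.val h0
    rw [Fin.val_one', Nat.mod_eq_of_lt (by omega)] at h2
    simp at h2
  simpa using h1

theorem act_simple (h : IsAffineAction cs act) (i : Fin (n + 1))
    (v : EuclideanSpace ℝ (Fin (n + 1))) :
    act (cs.simple i) v = rootRefl (i - 1) i (simpleShift i) v := by
  have hne := h.sub_one_ne i
  induction i using Fin.cases with
  | zero =>
    have hl : (0 - 1 : Fin (n + 1)) = Fin.last n := by
      apply Fin.ext; rw [zero_sub, Fin.coe_neg_one, Fin.val_last]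
    rw [hl] at hne
    have := reflN_single_sub_single hne.symm (-1) v
    push_cast at this
    rw [h.simple_zero, hiRoot, this, hl, ← rootRefl_comm hne.symm]
    simp [simpleShift]
  | succ i =>
    have hl : (i.succ - 1 : Fin (n + 1)) = i.castSucc := by
      apply Fin.ext; rw [Fin.val_sub_one_of_ne_zero (Fin.succ_ne_zero i)]; simp
    rw [hl] at hne
    have := reflN_single_sub_single hne 0 v
    push_cast at this
    rw [h.simple_succ, rootA, this, hl]
    simp [simpleShift, Fin.succ_ne_zero]

theorem act_mul (w w' : W) (v : EuclideanSpace ℝ (Fin (n + 1))) :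
    act (w * w') v = act w (act w' v) := by
  rw [map_mul]; rfl

theorem act_simple_simple (i : Fin (n + 1)) (v : EuclideanSpace ℝ (Fin (n + 1))) :
    act (cs.simple i) (act (cs.simple i) v) = v := by
  rw [← act_mul, cs.simple_mul_simple_self, map_one]; rfl

theorem wallForm_act_self (h : IsAffineAction cs act) (i : Fin (n + 1))
    (v : EuclideanSpace ℝ (Fin (n + 1))) :
    wallForm i (act (cs.simple i) v) = -wallForm i v := by
  rw [h.act_simple, wallForm, wallForm, rootRefl_apply, rootRefl_apply, if_neg (h.sub_one_ne i).symm,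
    if_pos rfl, if_pos rfl]
  ring

theorem wallForm_act_two (h : IsAffineAction cs act) (hn : n = 1) {i j : Fin (n + 1)} (hij : i ≠ j)
    (v : EuclideanSpace ℝ (Fin (n + 1))) :
    wallForm i (act (cs.simple j) v) = 1 + wallForm j v := by
  subst hn
  rw [h.act_simple, wallForm, wallForm, rootRefl_apply, rootRefl_apply]
  fin_cases i <;> fin_cases j <;> simp_all [simpleShift, show (-1 : Fin (1 + 1)) = 1 from rfl] <;> ring

theorem wallForm_act_adjacent (h : IsAffineAction cs act) (hn : n ≠ 1) {i j : Fin (n + 1)}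
    (hij : j = i + 1 ∨ i = j + 1) (v : EuclideanSpace ℝ (Fin (n + 1))) :
    wallForm i (act (cs.simple j) v) = wallForm i v + wallForm j v := by
  have h1 := h.sub_one_ne i
  have h2 := h.sub_one_ne j
  have h3 : (1 + 1 : Fin (n + 1)) ≠ 0 := by
    have := h.one_le
    intro h0
    have h2 := congrArg Fin.val h0
    rw [Fin.val_add, Fin.val_one', Nat.mod_eq_of_lt (a := 1) (by omega),
      Nat.mod_eq_of_lt (by omega)] at h2
    simp at h2
  rw [h.act_simple, wallForm, wallForm, wallForm, rootRefl_apply, rootRefl_apply]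
  rcases hij with rfl | rfl
  · have e1 : i + 1 - 1 = i := add_sub_cancel_right i 1
    have e2 : i - 1 ≠ i + 1 := fun h' => h3 (add_left_cancel (a := i) (by
      rw [add_zero, ← add_assoc, ← h', sub_add_cancel]))
    rw [e1] at h2 ⊢
    rw [if_pos rfl, if_neg h1, if_neg e2]
    ring
  · have e1 : j + 1 - 1 = j := add_sub_cancel_right j 1
    have e2 : j + 1 ≠ j - 1 := fun h' => h3 (add_left_cancel (a := j) (by
      rw [add_zero, ← add_assoc, h', sub_add_cancel]))
    rw [e1] at h1 ⊢
    rw [if_neg e2, if_neg h1.symm, if_neg h2.symm, if_pos rfl]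
    ring

theorem wallForm_act_far (h : IsAffineAction cs act) {i j : Fin (n + 1)} (hij : i ≠ j)
    (hij' : ¬ (j = i + 1 ∨ i = j + 1)) (v : EuclideanSpace ℝ (Fin (n + 1))) :
    wallForm i (act (cs.simple j) v) = wallForm i v := by
  push Not at hij'
  rw [h.act_simple, wallForm, wallForm, rootRefl_apply, rootRefl_apply,
    if_neg (fun h' => hij'.1 (by rw [h', sub_add_cancel])), if_neg hij,
    if_neg (fun h' => hij (sub_left_injective h')),
    if_neg (fun h' => hij'.2 (by rw [← h', sub_add_cancel]))]

/-- The length goes up along `s i` precisely on the fundamental side of the wall `i`. -/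
theorem wallForm_pos_of_length_lt (h : IsAffineAction cs act) (w : W) (i : Fin (n + 1))
    (hl : cs.length w < cs.length (cs.simple i * w)) :
    0 < wallForm i (act w (basePoint n)) := by
  induction hm : cs.length w using Nat.strong_induction_on generalizing w i with
  | _ m ih =>
  subst hm
  by_cases hw : w = 1
  · subst hw
    rw [map_one]
    exact wallForm_basePoint_pos i
  obtain ⟨j, hj⟩ := cs.exists_leftDescent_of_ne_one hw
  obtain ⟨w', rfl⟩ : ∃ w', w = cs.simple j * w' :=
    ⟨cs.simple j * w, by rw [cs.simple_mul_simple_cancel_left]⟩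
  have hj' : cs.length w' < cs.length (cs.simple j * w') := by
    rwa [CoxeterSystem.IsLeftDescent, cs.simple_mul_simple_cancel_left] at hj
  have hij : i ≠ j := by
    rintro rfl
    rw [cs.simple_mul_simple_cancel_left] at hl
    omega
  have hjpos := ih _ hj' w' j hj' rfl
  rw [act_mul]
  have hM := cs.simple_mul_simple_pow i j
  rw [h.matrix, if_neg hij] at hM
  by_cases hn : n = 1
  · rw [h.wallForm_act_two hn hij]
    linarith
  rw [if_neg hn] at hM
  have hw'j := cs.length_simple_mul w' j
  by_cases hadj : j = i + 1 ∨ i = j + 1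
  · rw [if_pos hadj] at hM
    have hbraid : cs.simple j * cs.simple i * cs.simple j =
        cs.simple i * cs.simple j * cs.simple i := by
      have h1 : (cs.simple i * cs.simple j * cs.simple i) *
          (cs.simple j * cs.simple i * cs.simple j) = 1 := by
        rw [← hM]; simp only [pow_succ, pow_zero, one_mul, mul_assoc]
      rw [← inv_eq_of_mul_eq_one_right h1]
      simp [mul_assoc]
    rw [h.wallForm_act_adjacent hn hadj]
    rcases cs.length_simple_mul w' i with hi | hi
    · linarith [ih _ hj' w' i (by omega) rfl]
    · obtain ⟨u, rfl⟩ : ∃ u, w' = cs.simple i * u :=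
        ⟨cs.simple i * w', by rw [cs.simple_mul_simple_cancel_left]⟩
      rw [cs.simple_mul_simple_cancel_left] at hi
      rw [act_mul, h.wallForm_act_self, h.wallForm_act_adjacent hn hadj.symm]
      suffices 0 < wallForm j (act u (basePoint n)) by linarith
      refine ih (cs.length u) (by omega) u j ?_ rfl
      rcases cs.length_simple_mul u j with h1 | h1
      · omega
      · obtain ⟨z, rfl⟩ : ∃ z, u = cs.simple j * z :=
          ⟨cs.simple j * u, by rw [cs.simple_mul_simple_cancel_left]⟩
        rw [cs.simple_mul_simple_cancel_left] at h1
        have e : cs.simple j * (cs.simple i * (cs.simple j * z)) =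
            cs.simple i * (cs.simple j * (cs.simple i * z)) := by
          simpa only [mul_assoc] using congrArg (· * z) hbraid
        rw [e, cs.simple_mul_simple_cancel_left] at hl
        rw [e] at hw'j
        have h2 := cs.length_simple_mul (cs.simple i * z) j
        have h3 := cs.length_simple_mul z i
        rw [e] at hj'
        omega
  · rw [if_neg hadj] at hM
    have hcomm : cs.simple i * cs.simple j = cs.simple j * cs.simple i := by
      have h1 : (cs.simple i * cs.simple j) * (cs.simple i * cs.simple j) = 1 := by
        rw [← hM, pow_two]
      rw [← inv_eq_of_mul_eq_one_right h1]
      simp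
    rw [h.wallForm_act_far hij hadj]
    refine ih _ hj' w' i ?_ rfl
    rw [← mul_assoc, hcomm, mul_assoc] at hl
    have h2 := cs.length_simple_mul (cs.simple i * w') j
    have h3 := cs.length_simple_mul w' i
    omega

theorem eq_one_of_act_basePoint (h : IsAffineAction cs act) {w : W}
    (hw : act w (basePoint n) = basePoint n) : w = 1 := by
  by_contra hne
  obtain ⟨i, hi⟩ := cs.exists_leftDescent_of_ne_one hne
  have h1 := h.wallForm_pos_of_length_lt (cs.simple i * w) i (by
    rwa [cs.simple_mul_simple_cancel_left])
  rw [act_mul, h.wallForm_act_self, hw] at h1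
  linarith [wallForm_basePoint_pos i]

theorem eq_of_act_basePoint (h : IsAffineAction cs act) {w w' : W}
    (hw : act w (basePoint n) = act w' (basePoint n)) : w = w' := by
  have : w'⁻¹ * w = 1 := h.eq_one_of_act_basePoint (by
    rw [act_mul, hw, ← act_mul, inv_mul_cancel, map_one]; rfl)
  exact (inv_mul_eq_one.1 this).symm

end IsAffineAction

/-- `f` permutes the coordinates and then adds an integer vector. -/
def IsIntegralPerm {n : ℕ} (f : EuclideanSpace ℝ (Fin (n + 1)) → EuclideanSpace ℝ (Fin (n + 1)))
    (π : Equiv.Perm (Fin (n + 1))) (κ : Fin (n + 1) → ℤ) : Prop :=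
  ∀ v e, f v e = v (π e) + κ e

theorem isIntegralPerm_rootRefl {n : ℕ} (c d : Fin (n + 1)) (k : ℤ) :
    IsIntegralPerm (rootRefl c d k) (Equiv.swap c d)
      (fun e => if e = c then k else if e = d then -k else 0) := by
  intro v e
  rw [rootRefl_apply, Equiv.swap_apply_def]
  dsimp only
  split_ifs <;> push_cast <;> ring

theorem IsIntegralPerm.comp {n : ℕ}
    {f g : EuclideanSpace ℝ (Fin (n + 1)) → EuclideanSpace ℝ (Fin (n + 1))}
    {π ρ : Equiv.Perm (Fin (n + 1))} {κ μ : Fin (n + 1) → ℤ} (hf : IsIntegralPerm f π κ)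
    (hg : IsIntegralPerm g ρ μ) :
    IsIntegralPerm (fun v => f (g v)) (π.trans ρ) (fun e => μ (π e) + κ e) := by
  intro v e
  rw [hf, hg]
  push_cast
  rw [Equiv.trans_apply]
  ring

theorem IsIntegralPerm.rootRefl_apply {n : ℕ}
    {f : EuclideanSpace ℝ (Fin (n + 1)) → EuclideanSpace ℝ (Fin (n + 1))}
    {π : Equiv.Perm (Fin (n + 1))} {κ : Fin (n + 1) → ℤ} (hf : IsIntegralPerm f π κ)
    (c d : Fin (n + 1)) (k : ℤ) (v : EuclideanSpace ℝ (Fin (n + 1))) :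
    rootRefl c d k (f v) = f (rootRefl (π c) (π d) (k - κ c + κ d) v) := by
  ext e
  rw [_root_.rootRefl_apply, hf, hf, hf, hf, _root_.rootRefl_apply]
  simp only [π.injective.eq_iff]
  split_ifs <;> subst_vars <;> push_cast <;> ring

/-- The window of `w`: the coordinates of the image of the base point, scaled to be integers. -/
def window {n : ℕ} {W : Type*} [Group W] (act : W →* Equiv.Perm (EuclideanSpace ℝ (Fin (n + 1))))
    (w : W) : ℕ → ℤ :=
  fun e => if h : e < n + 1 then ⌊((n : ℝ) + 1) * act w (basePoint n) ⟨e, h⟩⌋ else 0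

theorem window_of_le {n : ℕ} {W : Type*} [Group W]
    (act : W →* Equiv.Perm (EuclideanSpace ℝ (Fin (n + 1)))) (w : W) {e : ℕ} (he : n + 1 ≤ e) :
    window act w e = 0 :=
  dif_neg (not_lt.2 he)

theorem window_fin {n : ℕ} {W : Type*} [Group W]
    (act : W →* Equiv.Perm (EuclideanSpace ℝ (Fin (n + 1)))) (w : W) (e : Fin (n + 1)) :
    window act w e = ⌊((n : ℝ) + 1) * act w (basePoint n) e⌋ :=
  dif_pos e.2

theorem window_ext {x y : ℕ → ℤ} {n : ℕ} (hx : ∀ e, n + 1 ≤ e → x e = 0)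
    (hy : ∀ e, n + 1 ≤ e → y e = 0) (h : ∀ e : Fin (n + 1), x e = y e) : x = y := by
  funext e
  rcases lt_or_ge e (n + 1) with he | he
  · exact h ⟨e, he⟩
  · rw [hx e he, hy e he]

theorem shiftSwap_fin {n : ℕ} (x : ℕ → ℤ) (c d : Fin (n + 1)) (k : ℤ) (e : Fin (n + 1)) :
    shiftSwap (n + 1) x c d k e =
      if e = c then x d + k * (n + 1) else if e = d then x c - k * (n + 1) else x e := by
  unfold shiftSwap
  simp only [Fin.ext_iff]
  push_cast
  rfl

namespace IsAffineAction

variable {n : ℕ} {W : Type*} [Group W] {M : CoxeterMatrix (Fin (n + 1))}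
  {cs : CoxeterSystem M W} {act : W →* Equiv.Perm (EuclideanSpace ℝ (Fin (n + 1)))}

theorem exists_isIntegralPerm (h : IsAffineAction cs act) (w : W) :
    ∃ π κ, IsIntegralPerm (act w) π κ := by
  induction w using cs.simple_induction_left with
  | one => exact ⟨Equiv.refl _, 0, fun v e => by simp⟩
  | mul_simple_left w i ih =>
    obtain ⟨π, κ, hw⟩ := ih
    have h1 : ⇑(act (cs.simple i * w)) =
        fun v => rootRefl (i - 1) i (simpleShift i) (act w v) := by
      funext v
      rw [act_mul, h.act_simple]
    rw [h1]
    exact ⟨_, _, (isIntegralPerm_rootRefl _ _ _).comp hw⟩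

/-- Scaled coordinates of the image of the base point are integers. -/
theorem window_cast (h : IsAffineAction cs act) (w : W) (e : Fin (n + 1)) :
    (window act w e : ℝ) = ((n : ℝ) + 1) * act w (basePoint n) e := by
  obtain ⟨π, κ, hw⟩ := h.exists_isIntegralPerm w
  have hn : (n : ℝ) + 1 ≠ 0 := by positivity
  have : ((n : ℝ) + 1) * act w (basePoint n) e = (((π e : ℕ) + κ e * (n + 1) : ℤ) : ℝ) := by
    rw [hw, basePoint_apply]
    push_cast
    field_simp
  rw [window_fin, this, Int.floor_intCast]

theorem window_eq (h : IsAffineAction cs act) {w : W} {π : Equiv.Perm (Fin (n + 1))}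
    {κ : Fin (n + 1) → ℤ} (hw : IsIntegralPerm (act w) π κ) (e : Fin (n + 1)) :
    window act w e = (π e : ℕ) + κ e * (n + 1) := by
  have hn : (n : ℝ) + 1 ≠ 0 := by positivity
  have h1 := h.window_cast w e
  rw [hw, basePoint_apply] at h1
  have : (window act w e : ℝ) = (((π e : ℕ) + κ e * (n + 1) : ℤ) : ℝ) := by
    rw [h1]
    push_cast
    field_simp
  exact_mod_cast this

theorem window_mul (h : IsAffineAction cs act) {u : W} {π : Equiv.Perm (Fin (n + 1))}
    {κ : Fin (n + 1) → ℤ} (hu : IsIntegralPerm (act u) π κ) (w : W) (e : Fin (n + 1)) :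
    window act (u * w) e = window act w (π e) + κ e * (n + 1) := by
  obtain ⟨ρ, μ, hw⟩ := h.exists_isIntegralPerm w
  have h1 : IsIntegralPerm (act (u * w)) (π.trans ρ) (fun e => μ (π e) + κ e) := by
    intro v e
    rw [act_mul]
    exact hu.comp hw v e
  rw [h.window_eq h1, h.window_eq hw, Equiv.trans_apply]
  ring

theorem window_rootRefl_mul (h : IsAffineAction cs act) {t : W} {c d : Fin (n + 1)}
    {k : ℤ} (ht : ∀ v, act t v = rootRefl c d k v) (w : W) :
    window act (t * w) = shiftSwap (n + 1) (window act w) c d k := by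
  refine window_ext (n := n) (fun e => window_of_le act _) (fun e he => ?_) fun e => ?_
  · unfold shiftSwap
    rw [if_neg (by omega), if_neg (by omega), window_of_le act _ he]
  · have : IsIntegralPerm (act t) _ _ := fun v e => by
      rw [ht]
      exact isIntegralPerm_rootRefl c d k v e
    rw [h.window_mul this, shiftSwap_fin, Equiv.swap_apply_def]
    split_ifs <;> ring

theorem window_one (h : IsAffineAction cs act) (e : Fin (n + 1)) : window act 1 e = e := by
  have : IsIntegralPerm (act 1) (Equiv.refl _) (0 : Fin (n + 1) → ℤ) := fun v e => by simp
  simp [h.window_eq this]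

theorem window_injective (h : IsAffineAction cs act) : Function.Injective (window act) := by
  intro w w' hw
  refine h.eq_of_act_basePoint ?_
  have hn : (n : ℝ) + 1 ≠ 0 := by positivity
  ext e
  have h1 := h.window_cast w e
  rw [hw, h.window_cast w' e] at h1
  exact (mul_left_cancel₀ hn h1).symm

theorem eq_of_dvd_window_sub (h : IsAffineAction cs act) (w : W) {a b : ℕ} (ha : a < n + 1)
    (hb : b < n + 1) (hab : ((n + 1 : ℕ) : ℤ) ∣ window act w a - window act w b) : a = b := by
  obtain ⟨π, κ, hw⟩ := h.exists_isIntegralPerm w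
  have h1 := h.window_eq hw ⟨a, ha⟩
  have h2 := h.window_eq hw ⟨b, hb⟩
  simp only at h1 h2
  rw [h1, h2] at hab
  have h3 : ((n + 1 : ℕ) : ℤ) ∣ ((π ⟨a, ha⟩ : ℕ) : ℤ) - ((π ⟨b, hb⟩ : ℕ) : ℤ) := by
    obtain ⟨q, hq⟩ := hab
    refine ⟨q - κ ⟨a, ha⟩ + κ ⟨b, hb⟩, ?_⟩
    push_cast at hq ⊢
    linear_combination hq
  have h4 := (π ⟨a, ha⟩).2
  have h5 := (π ⟨b, hb⟩).2
  have h6 := Int.eq_zero_of_abs_lt_dvd h3 (by rw [abs_lt]; constructor <;> omega)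
  have : π ⟨a, ha⟩ = π ⟨b, hb⟩ := Fin.ext (by omega)
  simpa using π.injective this

theorem floorSum_window (h : IsAffineAction cs act) (w : W) (j : ℤ) :
    floorSum (n + 1) (window act w) (n + 1) j = floorSum (n + 1) (window act 1) (n + 1) j := by
  induction w using cs.simple_induction_left with
  | one => rfl
  | mul_simple_left w i ih =>
    have hne := h.sub_one_ne i
    rw [h.window_rootRefl_mul (h.act_simple i),
      floorSum_total_shiftSwap (Nat.succ_pos n) _ (by omega) (by omega) (by omega), ih]

theorem exists_rootRefl_of_isReflection (h : IsAffineAction cs act) {t : W}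
    (ht : cs.IsReflection t) :
    ∃ c d k, c ≠ d ∧ ∀ v, act t v = rootRefl c d k v := by
  obtain ⟨w, i, rfl⟩ := ht
  obtain ⟨π, κ, hw⟩ := h.exists_isIntegralPerm w
  set c := π.symm (i - 1) with hc
  set d := π.symm i with hd
  refine ⟨c, d, simpleShift i + κ c - κ d, fun h' => h.sub_one_ne i (π.symm.injective h'), ?_⟩
  intro v
  obtain ⟨v, rfl⟩ := (act w).surjective v
  rw [hw.rootRefl_apply, act_mul, act_mul, h.act_simple]
  have : act w⁻¹ (act w v) = v := by rw [← act_mul, inv_mul_cancel, map_one]; rfl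
  rw [this, hc, hd, Equiv.apply_symm_apply, Equiv.apply_symm_apply, add_sub_right_comm,
    add_sub_cancel_right, sub_add_cancel]

end IsAffineAction

theorem sub_mem_rootLatN {n : ℕ} {u v : EuclideanSpace ℝ (Fin (n + 1))} (hu : u ∈ rootLatN n)
    (hv : v ∈ rootLatN n) : u - v ∈ rootLatN n := by
  obtain ⟨a, rfl⟩ := hu
  obtain ⟨b, rfl⟩ := hv
  exact ⟨fun i => a i - b i, by simp only [sub_smul, Finset.sum_sub_distrib]⟩

theorem zsmul_mem_rootLatN {n : ℕ} {u : EuclideanSpace ℝ (Fin (n + 1))} (hu : u ∈ rootLatN n)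
    (k : ℤ) : k • u ∈ rootLatN n := by
  obtain ⟨a, rfl⟩ := hu
  exact ⟨fun i => k * a i, by simp only [mul_smul, Finset.smul_sum]⟩

theorem rootA_mem_rootLatN {n : ℕ} (i : Fin n) : rootA i ∈ rootLatN n :=
  ⟨fun j => if j = i then 1 else 0, by simp⟩

theorem single_sub_single_mem_rootLatN {n : ℕ} (c d : Fin (n + 1)) :
    (EuclideanSpace.single c 1 - EuclideanSpace.single d 1 : EuclideanSpace ℝ (Fin (n + 1))) ∈
      rootLatN n := by
  have h (e : Fin (n + 1)) :
      (EuclideanSpace.single e 1 - EuclideanSpace.single 0 1 : EuclideanSpace ℝ (Fin (n + 1))) ∈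
        rootLatN n := by
    induction e using Fin.induction with
    | zero => exact ⟨0, by simp⟩
    | succ i ih =>
      convert sub_mem_rootLatN ih (rootA_mem_rootLatN i) using 1
      rw [rootA]
      abel
  convert sub_mem_rootLatN (h c) (h d) using 1
  abel

namespace IsAffineAction

variable {n : ℕ} {W : Type*} [Group W] {M : CoxeterMatrix (Fin (n + 1))}
  {cs : CoxeterSystem M W} {act : W →* Equiv.Perm (EuclideanSpace ℝ (Fin (n + 1)))}

theorem sub_sub_mul_ne_zero {c d : Fin (n + 1)} (hcd : c ≠ d) (k : ℤ) :
    (c : ℤ) - (d : ℕ) - k * (n + 1) ≠ 0 := by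
  intro h0
  have h1 : ((n + 1 : ℕ) : ℤ) ∣ (c : ℤ) - (d : ℕ) := ⟨k, by push_cast; linarith⟩
  have := Int.eq_zero_of_abs_lt_dvd h1 (by rw [abs_lt]; constructor <;> omega)
  exact hcd (Fin.ext (by omega))

/-- A simple reflection whose wall is the only one separating the base point from its image. -/
theorem act_simple_eq_rootRefl (h : IsAffineAction cs act) (i : Fin (n + 1)) {c d : Fin (n + 1)}
    (hcd : c ≠ d) {k : ℤ}
    (hneg : ((c : ℤ) - (d : ℕ) - k * (n + 1)) *
      (window act (cs.simple i) c - window act (cs.simple i) d - k * (n + 1)) < 0)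
    (v : EuclideanSpace ℝ (Fin (n + 1))) : act (cs.simple i) v = rootRefl c d k v := by
  have hne := h.sub_one_ne i
  have hval := val_sub_val_add_simpleShift i
  have hw (e : Fin (n + 1)) : window act (cs.simple i) e =
      e + if e = i - 1 then 1 else if e = i then -1 else 0 := by
    have := h.window_rootRefl_mul (h.act_simple i) 1
    rw [mul_one] at this
    rw [this, shiftSwap_fin, h.window_one, h.window_one, h.window_one]
    split_ifs with h1 h2
    · rw [h1]; linarith
    · rw [h2]; linarith
    · ring
  rw [hw, hw] at hneg
  set X : ℤ := (c : ℤ) - (d : ℕ) - k * (n + 1) with hX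
  set a : ℤ := if c = i - 1 then 1 else if c = i then -1 else 0 with ha
  set b : ℤ := if d = i - 1 then 1 else if d = i then -1 else 0 with hb
  have hneg' : X * (X + (a - b)) < 0 := by rw [hX] at hneg ⊢; linarith
  have ha1 : a = 1 ∧ c = i - 1 ∨ a = -1 ∧ c = i ∨ a = 0 := by
    rw [ha]; split_ifs <;> simp_all
  have hb1 : b = 1 ∧ d = i - 1 ∨ b = -1 ∧ d = i ∨ b = 0 := by
    rw [hb]; split_ifs <;> simp_all
  have hn : (n : ℤ) + 1 ≠ 0 := by positivity
  have key : (a - b = 2 ∧ X = -1) ∨ (a - b = -2 ∧ X = 1) := by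
    have h1 : a - b ≤ 2 ∧ -2 ≤ a - b := by
      rcases ha1 with ⟨h1, -⟩ | ⟨h1, -⟩ | h1 <;> rcases hb1 with ⟨h2, -⟩ | ⟨h2, -⟩ | h2 <;>
        rw [h1, h2] <;> norm_num
    rcases mul_neg_iff.1 hneg' with h2 | h2 <;> omega
  rw [h.act_simple]
  rcases key with ⟨h1, h2⟩ | ⟨h1, h2⟩
  · have hc : c = i - 1 := by
      rcases ha1 with h3 | h3 | h3
      · exact h3.2
      all_goals exfalso; omega
    have hd : d = i := by
      rcases hb1 with h3 | h3 | h3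
      · exfalso; omega
      · exact h3.2
      · exfalso; omega
    subst hc hd
    have : k = simpleShift d := mul_right_cancel₀ hn (by linarith)
    rw [this]
  · have hc : c = i := by
      rcases ha1 with h3 | h3 | h3
      · exfalso; omega
      · exact h3.2
      · exfalso; omega
    have hd : d = i - 1 := by
      rcases hb1 with h3 | h3 | h3
      · exact h3.2
      all_goals exfalso; omega
    subst hc hd
    have : k = -simpleShift c := mul_right_cancel₀ hn (by linarith)
    rw [this, rootRefl_comm hne]

/-- If a reflecting hyperplane separates the base point from its image under `w`, then the
corresponding reflection shortens `w`. -/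
theorem exists_isReflection_length_lt (h : IsAffineAction cs act) {c d : Fin (n + 1)} (hcd : c ≠ d)
    {k : ℤ} {w : W} (hneg : ((c : ℤ) - (d : ℕ) - k * (n + 1)) *
      (window act w c - window act w d - k * (n + 1)) < 0) :
    ∃ t, cs.IsReflection t ∧ (∀ v, act t v = rootRefl c d k v) ∧
      cs.length (t * w) < cs.length w := by
  induction hm : cs.length w using Nat.strong_induction_on generalizing w c d k with
  | _ m ih =>
  subst hm
  by_cases hw : w = 1
  · subst hw
    rw [h.window_one, h.window_one] at hneg
    nlinarith
  obtain ⟨i, hi⟩ := cs.exists_leftDescent_of_ne_one hw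
  rw [CoxeterSystem.IsLeftDescent] at hi
  by_cases hs : ((c : ℤ) - (d : ℕ) - k * (n + 1)) *
      (window act (cs.simple i) c - window act (cs.simple i) d - k * (n + 1)) < 0
  · exact ⟨_, cs.isReflection_simple i, h.act_simple_eq_rootRefl i hcd hs, hi⟩
  obtain ⟨w', rfl⟩ : ∃ w', w = cs.simple i * w' :=
    ⟨cs.simple i * w, by rw [cs.simple_mul_simple_cancel_left]⟩
  rw [cs.simple_mul_simple_cancel_left] at hi
  obtain ⟨π, κ, hπ⟩ := h.exists_isIntegralPerm (cs.simple i)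
  rw [h.window_mul hπ, h.window_mul hπ] at hneg
  rw [h.window_eq hπ, h.window_eq hπ] at hs
  have hne := sub_sub_mul_ne_zero (π.injective.ne hcd) (k - κ c + κ d)
  obtain ⟨t, ht, hact, hlen⟩ := ih _ hi (c := π c) (d := π d) (k := k - κ c + κ d) (w := w')
    (π.injective.ne hcd) (by
      set X := (c : ℤ) - (d : ℕ) - k * (n + 1)
      set Y := window act w' (π c) + κ c * (n + 1) - (window act w' (π d) + κ d * (n + 1)) -
        k * (n + 1) with hY
      set Z := ((π c : ℕ) : ℤ) - (π d : ℕ) - (k - κ c + κ d) * (n + 1) with hZ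
      have e1 : (window act w' (π c)) - window act w' (π d) - (k - κ c + κ d) * (n + 1) = Y := by
        rw [hY]; ring
      have e2 : ((π c : ℕ) : ℤ) + κ c * (n + 1) - ((π d : ℕ) + κ d * (n + 1)) - k * (n + 1) = Z := by
        rw [hZ]; ring
      rw [e1]
      rw [e2] at hs
      rcases mul_neg_iff.1 hneg with h1 | h1 <;> rcases hne.lt_or_gt with h2 | h2 <;>
        nlinarith) rfl
  refine ⟨cs.simple i * t * (cs.simple i)⁻¹, ht.conj _, fun v => ?_, ?_⟩
  · rw [cs.inv_simple, act_mul, act_mul, hact, ← hπ.rootRefl_apply, act_simple_simple]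
  · have h1 := cs.length_simple_mul (t * w') i
    rw [cs.inv_simple, mul_assoc, cs.simple_mul_simple_cancel_left, mul_assoc]
    omega

/-- Every affine root reflection is realised by a reflection of the Coxeter group. -/
theorem exists_isReflection (h : IsAffineAction cs act)
    (htr : ∀ mu ∈ rootLatN n, ∃ T, ∀ v, act T v = v + mu) {c d : Fin (n + 1)} (hcd : c ≠ d)
    (k : ℤ) : ∃ t, cs.IsReflection t ∧ ∀ v, act t v = rootRefl c d k v := by
  have hne := sub_sub_mul_ne_zero hcd k
  set X := (c : ℤ) - (d : ℕ) - k * (n + 1) with hX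
  obtain ⟨T, hT⟩ := htr _ (zsmul_mem_rootLatN (single_sub_single_mem_rootLatN c d) (-X))
  have hp : IsIntegralPerm (act T) (Equiv.refl _)
      (fun e => if e = c then -X else if e = d then X else 0) := by
    intro v e
    rw [hT, Equiv.refl_apply]
    simp only [PiLp.add_apply, PiLp.smul_apply, PiLp.sub_apply, PiLp.single_apply]
    split_ifs with h1 h2 <;> simp
    exact absurd (h1.symm.trans h2) hcd
  obtain ⟨t, ht, hact, -⟩ := h.exists_isReflection_length_lt hcd (k := k) (w := T) (by
    rw [h.window_eq hp, h.window_eq hp, if_pos rfl, if_neg hcd.symm, if_pos rfl]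
    simp only [Equiv.refl_apply]
    have e1 : (c : ℤ) + -X * (n + 1) - ((d : ℕ) + X * (n + 1)) - k * (n + 1) =
      -((2 * n + 1) * X) := by rw [hX]; ring
    rw [e1]
    have : 0 < X * X := mul_self_pos.2 hne
    nlinarith)
  exact ⟨t, ht, hact⟩

/-- A length-increasing multiplication by a reflection raises the window in the majorization
preorder. -/
theorem majorizedBy_of_length_lt (h : IsAffineAction cs act) {a t : W} (ht : cs.IsReflection t)
    (hl : cs.length a < cs.length (t * a)) :
    MajorizedBy (n + 1) (window act a) (window act (t * a)) := by
  obtain ⟨c, d, k, hcd, hact⟩ := h.exists_rootRefl_of_isReflection ht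
  rw [h.window_rootRefl_mul hact]
  have hcd' : (c : ℕ) ≠ d := fun h' => hcd (Fin.ext h')
  have hpos : ¬ ((c : ℤ) - (d : ℕ) - k * (n + 1)) *
      (window act a c - window act a d - k * (n + 1)) < 0 := by
    intro hneg
    obtain ⟨t', -, hact', hl'⟩ := h.exists_isReflection_length_lt hcd hneg
    have : t' = t := h.eq_of_act_basePoint (by rw [hact, hact'])
    rw [this] at hl'
    omega
  have hne := sub_sub_mul_ne_zero hcd k
  have hn : (0 : ℤ) < n + 1 := by positivity
  rcases hne.lt_or_gt with h1 | h1
  · refine majorizedBy_shiftSwap (Nat.succ_pos n) _ hcd' c.2 ?_ ?_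
    · by_contra! hk
      nlinarith [c.2, d.2]
    · push_cast
      nlinarith
  · rw [← shiftSwap_comm _ _ hcd']
    refine majorizedBy_shiftSwap (Nat.succ_pos n) _ hcd'.symm d.2 ?_ ?_
    · by_contra! hk
      nlinarith [c.2, d.2]
    · push_cast
      nlinarith

theorem dominatedBy_of_bruhatLE (h : IsAffineAction cs act) {x y : W}
    (hy : DecreasingOn (n + 1) (window act y)) (hxy : bruhatLE cs x y) :
    DominatedBy (n + 1) (window act x) (window act y) := by
  refine MajorizedBy.dominatedBy (Nat.succ_pos n) ?_ hy
  rcases hxy with rfl | hlt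
  · exact MajorizedBy.refl _ _
  · clear hy
    induction hlt with
    | single h1 =>
      obtain ⟨⟨t, ht, rfl⟩, hl⟩ := h1
      exact h.majorizedBy_of_length_lt ht hl
    | tail _ h1 ih =>
      obtain ⟨⟨t, ht, rfl⟩, hl⟩ := h1
      exact ih.trans (h.majorizedBy_of_length_lt ht hl)

end IsAffineAction

/-- Moving a small amount between two entries keeps a window decreasing, provided the gaps that
shrink are either large or still positive after a larger move. -/
theorem decreasingOn_of_move {N : ℕ} {v v' u : ℕ → ℤ} {c d : ℕ} {δ : ℤ} {F : ℕ → Prop}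
    (hcd : c < d) (hv : DecreasingOn N v) (hδ : 0 ≤ δ) (hδN : δ ≤ N) (hc : v' c = v c + δ)
    (hd : v' d = v d - δ) (ho : ∀ e, e ≠ c → e ≠ d → v' e = v e) (hc' : v' c ≤ u c)
    (hd' : u d ≤ v' d) (ho' : ∀ e, e ≠ c → e ≠ d → v' e = u e)
    (hF : ∀ i, i + 1 < N → F i → v (i + 1) + N < v i)
    (hF' : ∀ i, i + 1 < N → ¬ F i → u (i + 1) < u i) : DecreasingOn N v' := by
  intro i hi
  have h1 := hv i hi
  by_cases hic : i + 1 = c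
  · have h2 := ho i (by omega) (by omega)
    have h3 := ho' i (by omega) (by omega)
    subst hic
    by_cases hFi : F i
    · linarith [hF i hi hFi]
    · linarith [hF' i hi hFi]
  by_cases hid : i = d
  · have h2 := ho (i + 1) (by omega) (by omega)
    have h3 := ho' (i + 1) (by omega) (by omega)
    subst hid
    by_cases hFi : F i
    · linarith [hF i hi hFi]
    · linarith [hF' i hi hFi]
  have h2 : v i ≤ v' i := by
    by_cases h3 : i = c
    · subst h3; linarith
    · exact (ho i h3 hid).ge
  have h3 : v' (i + 1) ≤ v (i + 1) := by
    by_cases h3 : i + 1 = d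
    · rw [h3]; linarith
    · exact (ho (i + 1) hic h3).le
  linarith

theorem decreasingOn_shiftSwap {N : ℕ} (hN : 0 < N) {u : ℕ → ℤ} {c d : ℕ} {k : ℤ} {F : ℕ → Prop}
    (hcd : c < d) (hu : DecreasingOn N u) (hdvd : ¬ (N : ℤ) ∣ u c - u d)
    (hlt : u c < u d + k * N) (hFu : ∀ i, i + 1 < N → F i → u (i + 1) + N < u i)
    (hF : ∀ m ≤ k, u c < u d + m * N → DecreasingOn N (shiftSwap N u c d m) →
      ∀ i, i + 1 < N → F i → shiftSwap N u c d m (i + 1) + N < shiftSwap N u c d m i)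
    (hF' : ∀ i, i + 1 < N → ¬ F i → shiftSwap N u c d k (i + 1) < shiftSwap N u c d k i) :
    DecreasingOn N (shiftSwap N u c d k) := by
  have hN' : (0 : ℤ) < N := by exact_mod_cast hN
  set q := (u c - u d) / (N : ℤ) with hq
  have h1 := Int.emod_nonneg (u c - u d) hN'.ne'
  have h2 := Int.emod_lt_of_pos (u c - u d) hN'
  have h3 : (u c - u d) % N ≠ 0 := fun h' => hdvd (Int.dvd_of_emod_eq_zero h')
  have h4 := Int.mul_ediv_add_emod (u c - u d) N
  rw [← hq] at h4
  set r := (u c - u d) % (N : ℤ)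
  have hr : 0 < r := lt_of_le_of_ne h1 h3.symm
  have hqk : q + 1 ≤ k := by
    by_contra! h5
    nlinarith
  have hc (m : ℤ) : shiftSwap N u c d m c = u d + m * N := by simp [shiftSwap]
  have hd (m : ℤ) : shiftSwap N u c d m d = u c - m * N := by simp [shiftSwap, hcd.ne']
  have ho (m : ℤ) (e : ℕ) (h5 : e ≠ c) (h6 : e ≠ d) : shiftSwap N u c d m e = u e := by
    simp [shiftSwap, h5, h6]
  suffices ∀ m, q + 1 ≤ m → m ≤ k → DecreasingOn N (shiftSwap N u c d m) from this k hqk le_rfl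
  intro m hm
  induction m, hm using Int.leInduction with
  | base =>
    intro hk
    refine decreasingOn_of_move (δ := N - r) (u := shiftSwap N u c d k) hcd hu (by linarith)
      (by linarith) ?_ ?_ (ho _) ?_ ?_ (fun e h5 h6 => (ho _ e h5 h6).trans (ho _ e h5 h6).symm)
      hFu hF'
    · rw [hc]; linarith
    · rw [hd]; linarith
    · rw [hc, hc]; nlinarith
    · rw [hd, hd]; nlinarith
  | succ m hm ih =>
    intro hk
    have hD := ih (by omega)
    have hlt' : u c < u d + m * N := by nlinarith
    refine decreasingOn_of_move (δ := N) (u := shiftSwap N u c d k) hcd hD hN'.le le_rfl ?_ ?_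
      (fun e h5 h6 => (ho _ e h5 h6).trans (ho _ e h5 h6).symm) ?_ ?_
      (fun e h5 h6 => (ho _ e h5 h6).trans (ho _ e h5 h6).symm) (hF m (by omega) hlt' hD) hF'
    · rw [hc, hc]; ring
    · rw [hd, hd]; ring
    · rw [hc, hc]; nlinarith
    · rw [hd, hd]; nlinarith

theorem dominatedBy_shiftSwap {N : ℕ} (hN : 0 < N) (x : ℕ → ℤ) {c d : ℕ} (hcd : c < d) {k : ℤ}
    (hlt : x c < x d + k * N) : DominatedBy N x (shiftSwap N x c d k) := by
  have hN' : (0 : ℤ) < N := by exact_mod_cast hN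
  intro p _ j
  rw [floorSum_shiftSwap hN x hcd]
  split_ifs
  · have := Int.ediv_le_ediv hN' (show x c - j ≤ x d + k * N - j by linarith)
    linarith
  · simp

theorem shiftSwap_dominatedBy_shiftSwap {N : ℕ} (hN : 0 < N) (x : ℕ → ℤ) {c d : ℕ} (hcd : c < d)
    {m k : ℤ} (hmk : m ≤ k) : DominatedBy N (shiftSwap N x c d m) (shiftSwap N x c d k) := by
  have hN' : (0 : ℤ) < N := by exact_mod_cast hN
  intro p _ j
  rw [floorSum_shiftSwap hN x hcd, floorSum_shiftSwap hN x hcd]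
  split_ifs
  · have := Int.ediv_le_ediv hN' (show x d + m * N - j ≤ x d + k * N - j by nlinarith)
    linarith
  · simp

theorem floorSum_translate {N : ℕ} (hN : 0 < N) (x L : ℕ → ℤ) (p : ℕ) (j : ℤ) :
    floorSum N (fun e => x e + L e * N) p j = floorSum N x p j + ∑ e ∈ Finset.range p, L e := by
  unfold floorSum
  simp only [add_mul_sub_ediv hN, Finset.sum_add_distrib]

theorem dominatedBy_translate_iff {N : ℕ} (hN : 0 < N) (x y L : ℕ → ℤ) :
    DominatedBy N (fun e => x e + L e * N) (fun e => y e + L e * N) ↔ DominatedBy N x y := by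
  unfold DominatedBy
  simp only [floorSum_translate hN, add_le_add_iff_right]

namespace IsAffineAction

variable {n : ℕ} {W : Type*} [Group W] {M : CoxeterMatrix (Fin (n + 1))}
  {cs : CoxeterSystem M W} {act : W →* Equiv.Perm (EuclideanSpace ℝ (Fin (n + 1)))}

/-- An elementary move up between elements with decreasing windows. -/
def StepUp (act : W →* Equiv.Perm (EuclideanSpace ℝ (Fin (n + 1)))) (w w' : W) : Prop :=
  DecreasingOn (n + 1) (window act w) ∧ DecreasingOn (n + 1) (window act w') ∧
    ∃ (c d : Fin (n + 1)) (k : ℤ), c < d ∧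
      window act w c < window act w d + k * (n + 1 : ℕ) ∧
      window act w' = shiftSwap (n + 1) (window act w) c d k

theorem StepUp.dominatedBy {w w' : W} (hs : StepUp act w w') :
    DominatedBy (n + 1) (window act w) (window act w') := by
  obtain ⟨-, -, c, d, k, hcd, hlt, he⟩ := hs
  rw [he]
  exact dominatedBy_shiftSwap (Nat.succ_pos n) _ hcd hlt

theorem StepUp.exists_isReflection (h : IsAffineAction cs act) {w w' : W} (hs : StepUp act w w') :
    (∃ t, cs.IsReflection t ∧ w' = t * w) ∧ cs.length w < cs.length w' := by
  obtain ⟨hw, -, c, d, k, hcd, hlt, he⟩ := hs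
  have h1 := hw.lt hcd d.2
  have hn : (0 : ℤ) < n + 1 := by positivity
  push_cast at hlt
  have hk : 0 < k := by
    by_contra! hk
    nlinarith
  have hcd' : (c : ℕ) < d := hcd
  obtain ⟨t, ht, hact, hl⟩ := h.exists_isReflection_length_lt hcd.ne (k := k) (w := w') (by
    rw [he, shiftSwap_fin, shiftSwap_fin, if_pos rfl, if_neg hcd.ne', if_pos rfl]
    apply mul_neg_of_neg_of_pos
    · nlinarith
    · linarith)
  have h2 : t * w' = w := h.window_injective (by
    rw [h.window_rootRefl_mul hact, he, shiftSwap_shiftSwap _ _ hcd'.ne])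
  refine ⟨⟨t, ht, ?_⟩, by rwa [h2] at hl⟩
  rw [← h2, ← mul_assoc, ht.mul_self, one_mul]

theorem exists_shiftSwap (h : IsAffineAction cs act)
    (htr : ∀ mu ∈ rootLatN n, ∃ T, ∀ v, act T v = v + mu) (w : W) {c d : ℕ} (hcd : c < d)
    (hd : d < n + 1) (k : ℤ) : ∃ w', window act w' = shiftSwap (n + 1) (window act w) c d k := by
  obtain ⟨t, -, hact⟩ := h.exists_isReflection htr (c := ⟨c, by omega⟩) (d := ⟨d, hd⟩)
    (by simp [hcd.ne]) k
  exact ⟨t * w, h.window_rootRefl_mul hact w⟩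

theorem reflTransGen_stepUp (h : IsAffineAction cs act)
    (htr : ∀ mu ∈ rootLatN n, ∃ T, ∀ v, act T v = v + mu) {x y : W}
    (hx : DecreasingOn (n + 1) (window act x)) (hy : DecreasingOn (n + 1) (window act y))
    (hxy : DominatedBy (n + 1) (window act x) (window act y)) :
    Relation.ReflTransGen (StepUp act) x y := by
  induction hm : (windowGap (n + 1) (window act x) (window act y)).toNat
    using Nat.strong_induction_on generalizing x with
  | _ m ih =>
  subst hm
  by_cases hne : ∃ e, e < n + 1 ∧ window act x e ≠ window act y e
  · obtain ⟨c, d, k, hcd, hd, hlt, hD, hle⟩ := exists_shiftSwap_dominatedBy (Nat.succ_pos n) hx hy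
      (fun a ha b hb => h.eq_of_dvd_window_sub x ha hb)
      (fun j => (h.floorSum_window x j).trans (h.floorSum_window y j).symm) hxy hne
    obtain ⟨x', hx'⟩ := h.exists_shiftSwap htr x hcd hd k
    rw [← hx'] at hD hle
    have hgap := windowGap_shiftSwap_lt (N := n + 1) (window act y) hcd hd hlt
    rw [← hx'] at hgap
    have h0 := windowGap_nonneg (N := n + 1) (Nat.succ_pos n) hle
    exact (ih _ (by omega) hD hle rfl).head
      ⟨hx, hD, ⟨c, by omega⟩, ⟨d, hd⟩, k, hcd, hlt, hx'⟩
  · push Not at hne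
    have : x = y := h.window_injective
      (window_ext (fun e => window_of_le act x) (fun e => window_of_le act y) fun e => hne e e.2)
    rw [this]

/-- On elements with decreasing windows, the Bruhat order is the vertexwise dominance order. -/
theorem bruhatLE_iff (h : IsAffineAction cs act)
    (htr : ∀ mu ∈ rootLatN n, ∃ T, ∀ v, act T v = v + mu) {x y : W}
    (hx : DecreasingOn (n + 1) (window act x)) (hy : DecreasingOn (n + 1) (window act y)) :
    bruhatLE cs x y ↔ DominatedBy (n + 1) (window act x) (window act y) := by
  refine ⟨h.dominatedBy_of_bruhatLE hy, fun hxy => ?_⟩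
  have := h.reflTransGen_stepUp htr hx hy hxy
  rcases Relation.reflTransGen_iff_eq_or_transGen.1 this with rfl | hlt
  · exact Or.inl rfl
  · exact Or.inr (Relation.TransGen.mono (fun a b hab => StepUp.exists_isReflection h hab) _ _ hlt)

end IsAffineAction

theorem coords_of_mem_rootLatN {n : ℕ} {lam : EuclideanSpace ℝ (Fin (n + 1))}
    (hlam : lam ∈ rootLatN n) :
    ∃ L : ℕ → ℤ, (∀ e, n + 1 ≤ e → L e = 0) ∧ ∀ e : Fin (n + 1), lam e = L e := by
  obtain ⟨c, rfl⟩ := hlam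
  refine ⟨fun e => ∑ i : Fin n, c i * ((if e = (i : ℕ) then 1 else 0) -
    if e = (i : ℕ) + 1 then 1 else 0), fun e he => ?_, fun e => ?_⟩
  · refine Finset.sum_eq_zero fun i _ => ?_
    rw [if_neg (by omega), if_neg (by omega)]
    ring
  · rw [WithLp.ofLp_sum, Finset.sum_apply, Int.cast_sum]
    refine Finset.sum_congr rfl fun i _ => ?_
    simp [rootA, Fin.ext_iff]

theorem inner_rootA {n : ℕ} (i : Fin n) (v : EuclideanSpace ℝ (Fin (n + 1))) :
    ⟪rootA i, v⟫ = v i.castSucc - v i.succ :=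
  inner_single_sub_single _ _ v

theorem mem_AplusN_iff {n : ℕ} {v : EuclideanSpace ℝ (Fin (n + 1))} :
    v ∈ AplusN n ↔ ∀ a b, a < b → -1 < v a - v b ∧ v a - v b < 0 := by
  constructor
  · intro hv a b hab
    rw [← inner_single_sub_single]
    exact hv _ ⟨a, b, hab, rfl⟩
  · rintro hv _ ⟨a, b, hab, rfl⟩
    rw [inner_single_sub_single]
    exact hv a b hab

theorem basePoint_sub_mem {n : ℕ} {a b : Fin (n + 1)} (hab : a < b) :
    -1 < basePoint n a - basePoint n b ∧ basePoint n a - basePoint n b < 0 := by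
  have hn : (0 : ℝ) < n + 1 := by positivity
  have h1 : (a : ℝ) < (b : ℕ) := by exact_mod_cast hab
  have h2 : ((b : ℕ) : ℝ) < n + 1 := by exact_mod_cast b.2
  have h3 : (0 : ℝ) ≤ (a : ℕ) := by positivity
  rw [basePoint_apply, basePoint_apply, ← sub_div, lt_div_iff₀ hn, div_lt_iff₀ hn]
  constructor <;> linarith

theorem mem_closure_AplusN {n : ℕ} {p : EuclideanSpace ℝ (Fin (n + 1))}
    (hp : ∀ a b, a < b → -1 ≤ p a - p b ∧ p a - p b ≤ 0) : p ∈ closure (AplusN n) := by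
  have h1 : openSegment ℝ p (basePoint n) ⊆ AplusN n := by
    rintro _ ⟨s, t, hs, ht, hst, rfl⟩
    rw [mem_AplusN_iff]
    intro a b hab
    have h1 := hp a b hab
    have h2 := basePoint_sub_mem hab
    simp only [PiLp.add_apply, PiLp.smul_apply, smul_eq_mul]
    constructor <;> nlinarith
  refine closure_mono h1 ?_
  rw [closure_openSegment]
  exact left_mem_segment ℝ _ _

theorem IsIntegralPerm.continuous {n : ℕ}
    {f : EuclideanSpace ℝ (Fin (n + 1)) → EuclideanSpace ℝ (Fin (n + 1))}
    {π : Equiv.Perm (Fin (n + 1))} {κ : Fin (n + 1) → ℤ} (hf : IsIntegralPerm f π κ) :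
    Continuous f := by
  have : f = fun v : EuclideanSpace ℝ (Fin (n + 1)) =>
      WithLp.toLp 2 fun e => v (π e) + κ e := by
    funext v
    ext e
    exact hf v e
  rw [this]
  fun_prop

namespace IsAffineAction

variable {n : ℕ} {W : Type*} [Group W] {M : CoxeterMatrix (Fin (n + 1))}
  {cs : CoxeterSystem M W} {act : W →* Equiv.Perm (EuclideanSpace ℝ (Fin (n + 1)))}

/-- Dominant elements are those with decreasing window. -/
theorem domN_iff (h : IsAffineAction cs act) (w : W) :
    DomN act w ↔ DecreasingOn (n + 1) (window act w) := by
  have hn : (0 : ℝ) < n + 1 := by positivity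
  constructor
  · intro hw i hi
    have h1 := hw ⟨_, mem_AplusN_iff.2 fun a b hab => basePoint_sub_mem hab, rfl⟩ ⟨i, by omega⟩
    rw [inner_rootA] at h1
    have h2 := h.window_cast w (Fin.castSucc ⟨i, by omega⟩)
    have h3 := h.window_cast w (Fin.succ ⟨i, by omega⟩)
    simp only [Fin.val_castSucc, Fin.val_succ] at h2 h3
    have : (window act w (i + 1) : ℝ) < window act w i := by
      rw [h2, h3]
      exact mul_lt_mul_of_pos_left (by linarith) hn
    exact_mod_cast this
  · rintro hw _ ⟨v, hv, rfl⟩ i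
    rw [mem_AplusN_iff] at hv
    obtain ⟨π, κ, hπ⟩ := h.exists_isIntegralPerm w
    have h1 := hw i (by omega)
    have h2 := h.window_eq hπ i.castSucc
    have h3 := h.window_eq hπ i.succ
    simp only [Fin.val_castSucc, Fin.val_succ] at h2 h3
    rw [h2, h3] at h1
    have hne : π i.castSucc ≠ π i.succ := π.injective.ne (Fin.castSucc_lt_succ (i := i)).ne
    have h4 := (π i.castSucc).2
    have h5 := (π i.succ).2
    have h6 : κ i.succ ≤ κ i.castSucc := by
      by_contra! h6
      nlinarith
    rw [inner_rootA, hπ, hπ]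
    rcases h6.eq_or_lt with h7 | h7
    · rw [h7] at h1 ⊢
      have := hv (π i.succ) (π i.castSucc) (by rw [Fin.lt_def]; omega)
      linarith
    · have h8 : (κ i.succ : ℝ) + 1 ≤ κ i.castSucc := by exact_mod_cast h7
      rcases hne.lt_or_gt with h9 | h9 <;> linarith [hv _ _ h9]

/-- A dominant alcove whose closure misses a wall of the dominant chamber lies beyond the next
parallel hyperplane. -/
theorem window_gap (h : IsAffineAction cs act) {u : W}
    (hu : DecreasingOn (n + 1) (window act u)) (i : Fin n)
    (hcl : ¬ ∃ v ∈ closure (⇑(act u) '' AplusN n), ⟪rootA i, v⟫ = 0) :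
    window act u (i + 1) + (n + 1 : ℕ) < window act u i := by
  obtain ⟨π, κ, hπ⟩ := h.exists_isIntegralPerm u
  contrapose! hcl
  have h1 := hu i (by omega)
  have h2 := h.window_eq hπ i.castSucc
  have h3 := h.window_eq hπ i.succ
  simp only [Fin.val_castSucc, Fin.val_succ] at h2 h3
  rw [h2, h3] at h1 hcl
  have hne : π i.castSucc ≠ π i.succ := π.injective.ne (Fin.castSucc_lt_succ (i := i)).ne
  have h4 := (π i.castSucc).2
  have h5 := (π i.succ).2
  push_cast at hcl
  suffices ∃ p ∈ closure (AplusN n), p (π i.castSucc) - p (π i.succ) +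
      (κ i.castSucc - κ i.succ) = 0 by
    obtain ⟨p, hp, hp0⟩ := this
    refine ⟨act u p, image_closure_subset_closure_image hπ.continuous ⟨p, hp, rfl⟩, ?_⟩
    rw [inner_rootA, hπ, hπ]
    linarith
  have h6 : κ i.succ ≤ κ i.castSucc := by
    by_contra! h6
    nlinarith
  have h7 : κ i.castSucc ≤ κ i.succ + 1 := by
    by_contra! h7
    nlinarith
  rcases h6.eq_or_lt with h8 | h8
  · exact ⟨0, mem_closure_AplusN (by simp), by rw [h8]; simp⟩
  · have h9 : κ i.castSucc = κ i.succ + 1 := by omega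
    have h10 : π i.castSucc < π i.succ := by
      rw [h9] at hcl
      refine lt_of_le_of_ne ?_ hne
      rw [Fin.le_def]
      have : ((π i.castSucc : ℕ) : ℤ) ≤ (π i.succ : ℕ) := by linarith
      exact_mod_cast this
    refine ⟨WithLp.toLp 2 fun e => if π i.succ ≤ e then 1 else 0,
      mem_closure_AplusN fun a b hab => ?_, ?_⟩
    · dsimp only
      split_ifs with ha hb
      · norm_num
      · exact absurd (ha.trans hab.le) hb
      · norm_num
      · norm_num
    · dsimp only
      rw [if_neg (not_le.2 h10), if_pos le_rfl, h9]
      push_cast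
      ring

theorem window_translate (h : IsAffineAction cs act) {w w' : W}
    {lam : EuclideanSpace ℝ (Fin (n + 1))} {L : ℕ → ℤ} (hL0 : ∀ e, n + 1 ≤ e → L e = 0)
    (hL : ∀ e : Fin (n + 1), lam e = L e) (hw : ∀ v, act w' v = act w v + lam) :
    window act w' = fun e => window act w e + L e * (n + 1 : ℕ) := by
  refine window_ext (n := n) (fun e => window_of_le act _) (fun e he => ?_) fun e => ?_
  · rw [window_of_le act _ he, hL0 e he]
    ring
  · have h1 := h.window_cast w' e
    rw [hw, PiLp.add_apply, hL, mul_add, ← h.window_cast] at h1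
    have : (window act w' e : ℝ) = ((window act w e + L e * (n + 1 : ℕ) : ℤ) : ℝ) := by
      rw [h1]
      push_cast
      ring
    exact_mod_cast this

theorem decreasingOn_of_translate (h : IsAffineAction cs act)
    (htr : ∀ mu ∈ rootLatN n, ∃ T, ∀ v, act T v = v + mu) {x y x' : W} {L : ℕ → ℤ}
    (hx : DecreasingOn (n + 1) (window act x))
    (hsub : ∀ w, ∃ u, window act w = fun e => window act u e + L e * (n + 1 : ℕ))
    (hgap : ∀ u, DecreasingOn (n + 1) (window act u) →
      DominatedBy (n + 1) (window act x) (window act u) →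
      DominatedBy (n + 1) (window act u) (window act y) →
      ∀ i, i + 1 < n + 1 → L i ≠ L (i + 1) →
        window act u (i + 1) + (n + 1 : ℕ) < window act u i)
    (hx' : window act x' = fun e => window act x e + L e * (n + 1 : ℕ)) {w : W}
    (hch : Relation.ReflTransGen (StepUp act) x' w)
    (hwy : DominatedBy (n + 1) (window act w) fun e => window act y e + L e * (n + 1 : ℕ)) {u : W}
    (hu : window act w = fun e => window act u e + L e * (n + 1 : ℕ)) :
    DecreasingOn (n + 1) (window act u) ∧
      DominatedBy (n + 1) (window act x) (window act u) := by
  have hN : 0 < n + 1 := Nat.succ_pos n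
  induction hch generalizing u with
  | refl =>
    have : window act x = window act u := by
      funext e
      have := congrFun (hx'.symm.trans hu) e
      simpa using this
    rw [← this]
    exact ⟨hx, fun _ _ _ => le_rfl⟩
  | @tail w w' _ hs ih =>
    obtain ⟨v, hv⟩ := hsub w
    obtain ⟨hvD, hxv⟩ := ih (hs.dominatedBy.trans hwy) hv
    obtain ⟨hw, hw', c, d, k, hcd, hlt, he⟩ := hs
    have hcd' : (c : ℕ) < d := hcd
    set k' := k - (L c - L d) with hk'
    have he' : window act u = shiftSwap (n + 1) (window act v) c d k' := by
      funext e
      have h1 := congrFun (hu.symm.trans he) e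
      rw [hv] at h1
      simp only [shiftSwap] at h1 ⊢
      rw [hk']
      split_ifs at h1 ⊢ with h2 h3
      · subst h2; linear_combination h1
      · subst h3; linear_combination h1
      · linarith
    have hlt' : window act v c < window act v d + k' * (n + 1 : ℕ) := by
      simp only [hv] at hlt
      rw [hk']
      linarith
    have huy : DominatedBy (n + 1) (window act u) (window act y) := by
      rw [hu] at hwy
      exact (dominatedBy_translate_iff hN _ _ L).1 hwy
    have hvu : DominatedBy (n + 1) (window act v) (window act u) := by
      rw [he']
      exact dominatedBy_shiftSwap hN _ hcd hlt'
    refine ⟨?_, hxv.trans hvu⟩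
    rw [he']
    refine decreasingOn_shiftSwap hN (F := fun i => L i ≠ L (i + 1)) hcd hvD
      (fun hdvd => hcd'.ne (h.eq_of_dvd_window_sub v c.2 d.2 hdvd)) hlt'
      (hgap v hvD hxv (hvu.trans huy)) (fun m hm hltm hDm => ?_) fun i hi hLi => ?_
    · obtain ⟨z, hz⟩ := h.exists_shiftSwap htr v hcd' d.2 m
      rw [← hz] at hDm ⊢
      refine hgap z hDm (hxv.trans ?_) (DominatedBy.trans ?_ huy)
      · rw [hz]
        exact dominatedBy_shiftSwap hN _ hcd hltm
      · rw [hz, he']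
        exact shiftSwap_dominatedBy_shiftSwap hN _ hcd hm
    · rw [← he']
      have h1 := hw' i hi
      rw [not_not] at hLi
      simp only [hu, hLi] at h1
      linarith

end IsAffineAction

/-- in type `Ãₙ`, translation by a root-lattice element supported away from
the walls met by `[x, y]` is a poset isomorphism on the dominant parts of the intervals. -/
theorem statement19
    {n : ℕ} (hn : 1 ≤ n)
    {W : Type*} [Group W] {M : CoxeterMatrix (Fin (n + 1))} (cs : CoxeterSystem M W)
    (hM : ∀ i j : Fin (n + 1), M i j =
      if i = j then 1 else if n = 1 then 0 else if j = i + 1 ∨ i = j + 1 then 3 else 2)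
    (act : W →* Equiv.Perm (EuclideanSpace ℝ (Fin (n + 1))))
    (hact0 : ∀ v, act (cs.simple 0) v = reflN (hiRoot n) (-1) v)
    (hacts : ∀ (i : Fin n) (v), act (cs.simple i.succ) v = reflN (rootA i) 0 v)
    (fwt : Fin (n + 1) → EuclideanSpace ℝ (Fin (n + 1)))
    (hfwt0 : fwt 0 = 0)
    (hfwtsum : ∀ j, ∑ k, fwt j k = 0)
    (hfwt : ∀ i j : Fin n, ⟪rootA i, fwt j.succ⟫ = if i = j then 1 else 0)
    (Wadd : W → EuclideanSpace ℝ (Fin (n + 1)) → W)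
    (hWadd : ∀ (z : W), ∀ mu ∈ rootLatN n, ∀ v, act (Wadd z mu) v = act z v + mu)
    (x y : W) (hx : DomN act x) (hy : DomN act y) (hxy : bruhatLE cs x y)
    (lam : EuclideanSpace ℝ (Fin (n + 1))) (hlam1 : lam ∈ rootLatN n)
    (hlam2 : ∃ c : Fin n → ℕ,
      (∀ i : Fin n,
        (∃ z : W, DomN act z ∧ bruhatLE cs x z ∧ bruhatLE cs z y ∧
          ∃ v ∈ closure (⇑(act z) '' AplusN n), ⟪rootA i, v⟫ = 0) → c i = 0) ∧
      lam = ∑ i, (c i : ℝ) • fwt i.succ) :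
    Set.BijOn (fun z => Wadd z lam)
      {z : W | DomN act z ∧ bruhatLE cs x z ∧ bruhatLE cs z y}
      {z : W | DomN act z ∧ bruhatLE cs (Wadd x lam) z ∧ bruhatLE cs z (Wadd y lam)} ∧
    ∀ u ∈ {z : W | DomN act z ∧ bruhatLE cs x z ∧ bruhatLE cs z y},
      ∀ w ∈ {z : W | DomN act z ∧ bruhatLE cs x z ∧ bruhatLE cs z y},
        (bruhatLE cs u w ↔ bruhatLE cs (Wadd u lam) (Wadd w lam)) := by
  have h : IsAffineAction cs act := ⟨hn, hM, hact0, hacts⟩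
  have hN : 0 < n + 1 := Nat.succ_pos n
  have htr : ∀ mu ∈ rootLatN n, ∃ T, ∀ v, act T v = v + mu := fun mu hmu =>
    ⟨Wadd 1 mu, fun v => by rw [hWadd 1 mu hmu, map_one]; rfl⟩
  obtain ⟨L, hL0, hL⟩ := coords_of_mem_rootLatN hlam1
  obtain ⟨c, hc0, hc⟩ := hlam2
  have hneg : -lam ∈ rootLatN n := by
    simpa using zsmul_mem_rootLatN hlam1 (-1)
  have hLc (i : Fin n) : L i - L (i + 1) = c i := by
    have h1 : ⟪rootA i, lam⟫ = (c i : ℝ) := by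
      rw [hc, inner_sum]
      simp [inner_smul_right, hfwt]
    rw [inner_rootA, hL, hL, Fin.val_castSucc, Fin.val_succ] at h1
    have h2 : ((L i - L (i + 1) : ℤ) : ℝ) = ((c i : ℤ) : ℝ) := by
      push_cast
      exact h1
    exact Int.cast_injective h2
  have hadd (z : W) : window act (Wadd z lam) = fun e => window act z e + L e * (n + 1 : ℕ) :=
    h.window_translate hL0 hL (hWadd z lam hlam1)
  have hsub (z : W) : window act z =
      fun e => window act (Wadd z (-lam)) e + L e * (n + 1 : ℕ) :=
    h.window_translate hL0 hL fun v => by rw [hWadd z _ hneg]; abel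
  have hdec {z : W} (hz : DecreasingOn (n + 1) (window act z)) :
      DecreasingOn (n + 1) (window act (Wadd z lam)) := by
    intro i hi
    have h1 := hz i hi
    have h2 := hLc ⟨i, by omega⟩
    simp only at h2
    rw [hadd]
    dsimp only
    have h3 : L (i + 1) ≤ L i := by omega
    have h4 : L (i + 1) * (n + 1 : ℕ) ≤ L i * (n + 1 : ℕ) :=
      mul_le_mul_of_nonneg_right h3 (by positivity)
    linarith
  have hiff {u w : W} (hu : DecreasingOn (n + 1) (window act u))
      (hw : DecreasingOn (n + 1) (window act w)) :
      bruhatLE cs u w ↔ bruhatLE cs (Wadd u lam) (Wadd w lam) := by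
    rw [h.bruhatLE_iff htr hu hw, h.bruhatLE_iff htr (hdec hu) (hdec hw), hadd, hadd,
      dominatedBy_translate_iff hN]
  simp only [h.domN_iff] at hx hy hc0 ⊢
  refine ⟨⟨?_, ?_, ?_⟩, fun u hu w hw => hiff hu.1 hw.1⟩
  · rintro z ⟨hz, hxz, hzy⟩
    exact ⟨hdec hz, (hiff hx hz).1 hxz, (hiff hz hy).1 hzy⟩
  · intro z _ w _ hzw
    refine h.window_injective (funext fun e => ?_)
    have h1 := congrArg (fun u => window act u e) hzw
    simpa [hadd] using h1
  · rintro z ⟨hz, hxz, hzy⟩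
    have hxz' := h.dominatedBy_of_bruhatLE hz hxz
    have hzy' := h.dominatedBy_of_bruhatLE (hdec hy) hzy
    rw [hadd] at hzy'
    obtain ⟨hD, hxu⟩ := h.decreasingOn_of_translate (y := y) htr hx (fun w => ⟨_, hsub w⟩)
      (fun u hu hxu huy i hi hLi => h.window_gap hu ⟨i, by omega⟩ fun hcl => by
        have h1 := hc0 ⟨i, by omega⟩
          ⟨u, hu, (h.bruhatLE_iff htr hx hu).2 hxu, (h.bruhatLE_iff htr hu hy).2 huy, hcl⟩
        have h2 := hLc ⟨i, by omega⟩
        rw [h1] at h2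
        simp only at h2
        omega)
      (hadd x) (h.reflTransGen_stepUp htr (hdec hx) hz hxz') hzy' (hsub z)
    rw [hsub z, dominatedBy_translate_iff hN] at hzy'
    refine ⟨Wadd z (-lam), ⟨hD, (h.bruhatLE_iff htr hx hD).2 hxu,
      (h.bruhatLE_iff htr hD hy).2 hzy'⟩, h.window_injective ?_⟩
    rw [hsub z]
    exact hadd _
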